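/- Let d ≥ 2 be even and let w be a weight function on [0,1). Then w is harmonically approximable on B_d (i.e., there exist finitely many harmonic functions f₁,…,f_J on B_d with |f₁| + ⋯ + |f_J| ≍ w(|x|)) if and only if w is equivalent to a log-convex weight function. -/

import Mathlib

open MeasureTheory Set Metric

noncomputable section

/-- The open unit ball of `ℝ^d` (as `EuclideanSpace`). -/
def unitBall (d : ℕ) : Set (EuclideanSpace ℝ (Fin d)) := Metric.ball 0 1

/-- `f` is harmonic on `s ⊆ ℝ^d`: it is `C²` on a neighborhood-like set and its
Laplacian (sum of second derivatives in the coordinate directions) vanishes on `s`. -/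
def IsHarmonicOn {d : ℕ} (f : EuclideanSpace ℝ (Fin d) → ℝ)
    (s : Set (EuclideanSpace ℝ (Fin d))) : Prop :=
  ContDiffOn ℝ 2 f s ∧ ∀ x ∈ s,
    ∑ i : Fin d, fderiv ℝ (fun y => fderiv ℝ f y (EuclideanSpace.single i 1)) x
      (EuclideanSpace.single i 1) = 0

/-- A weight function: positive, non-decreasing, continuous and unbounded on `[0,1)`. -/
def IsWeight (w : ℝ → ℝ) : Prop :=
  ContinuousOn w (Set.Ico 0 1) ∧ MonotoneOn w (Set.Ico 0 1) ∧
    (∀ r ∈ Set.Ico (0:ℝ) 1, 0 < w r) ∧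
    ∀ M : ℝ, ∃ r ∈ Set.Ico (0:ℝ) 1, M < w r

/-- `w` is log-convex: `log (w r)` is a convex function of `log r` on `(0,1)`. -/
def IsLogConvex (w : ℝ → ℝ) : Prop :=
  ConvexOn ℝ (Set.Iio (0:ℝ)) (fun t => Real.log (w (Real.exp t)))

/-- Two functions are equivalent on `[0,1)`. -/
def EquivOn01 (w v : ℝ → ℝ) : Prop :=
  ∃ c₁ c₂ : ℝ, 0 < c₁ ∧ 0 < c₂ ∧
    ∀ r ∈ Set.Ico (0:ℝ) 1, c₁ * v r ≤ w r ∧ w r ≤ c₂ * v r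

/-- The normalized surface measure on the unit sphere of `ℝ^d`. -/
def sphereMeasure (d : ℕ) : Measure (Metric.sphere (0 : EuclideanSpace ℝ (Fin d)) 1) :=
  ((volume : Measure (EuclideanSpace ℝ (Fin d))).toSphere Set.univ)⁻¹ •
    (volume : Measure (EuclideanSpace ℝ (Fin d))).toSphere

/-- The squared `L²`-mean of `f` on the sphere of radius `r`. -/
def M2sq {d : ℕ} (f : EuclideanSpace ℝ (Fin d) → ℝ) (r : ℝ) : ℝ :=
  ∫ y : Metric.sphere (0 : EuclideanSpace ℝ (Fin d)) 1,
    (f (r • (y : EuclideanSpace ℝ (Fin d))))^2 ∂(sphereMeasure d)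

/-- `bA b n m` is the deficit at `τ n` of the line `m`. -/
def tauB (b : ℕ → ℝ) (n : ℕ) : ℝ := b n - b (n + 1)

def bA (b : ℕ → ℝ) (n m : ℕ) : ℝ := b n - b m - ((m : ℝ) - n) * tauB b n

def bB (b : ℕ → ℝ) (n m : ℕ) : ℝ := b m - b n + ((m : ℝ) - n) * tauB b (m - 1)

lemma tau_sum_ge (b : ℕ → ℝ) (hb : Monotone (tauB b)) (n p : ℕ) :
    (p : ℝ) * tauB b n ≤ b n - b (n + p) := by
  induction p with
  | zero => simp
  | succ p ih =>
    have h := hb (show n ≤ n + p by omega)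
    have h2 : tauB b (n + p) = b (n + p) - b (n + p + 1) := rfl
    rw [← add_assoc]
    push_cast
    linarith

lemma tau_sum_le (b : ℕ → ℝ) (n p : ℕ) (t : ℝ)
    (ht : ∀ j < p, tauB b (n + j) ≤ t) :
    b n - b (n + p) ≤ (p : ℝ) * t := by
  induction p with
  | zero => simp
  | succ p ih =>
    have h := ht p (by omega)
    have h2 : tauB b (n + p) = b (n + p) - b (n + p + 1) := rfl
    have := ih (fun j hj => ht j (by omega))
    rw [← add_assoc]
    push_cast
    linarith

lemma tau_ge (b : ℕ → ℝ) (hb : Monotone (tauB b)) {n m : ℕ} (h : n ≤ m) {t : ℝ}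
    (ht : t ≤ tauB b n) : ((m : ℝ) - n) * t ≤ b n - b m := by
  obtain ⟨p, rfl⟩ := Nat.exists_eq_add_of_le h
  have := tau_sum_ge b hb n p
  push_cast
  have : (p : ℝ) * t ≤ p * tauB b n := by gcongr
  linarith

lemma tau_le (b : ℕ → ℝ) {n m : ℕ} (h : n ≤ m) {t : ℝ}
    (ht : ∀ j < m, tauB b j ≤ t) : b n - b m ≤ ((m : ℝ) - n) * t := by
  obtain ⟨p, rfl⟩ := Nat.exists_eq_add_of_le h
  have := tau_sum_le b n p t (fun j hj => ht _ (by omega))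
  push_cast
  linarith

lemma bA_mono (b : ℕ → ℝ) (hb : Monotone (tauB b)) {n m m' : ℕ} (h : n ≤ m) (h' : m ≤ m') :
    bA b n m ≤ bA b n m' := by
  unfold bA
  have := tau_ge b hb h' (hb h)
  linarith

lemma bB_mono (b : ℕ → ℝ) (hb : Monotone (tauB b)) {n m m' : ℕ} (h : n < m) (h' : m ≤ m') :
    bB b n m ≤ bB b n m' := by
  unfold bB
  have h1 : b m - b m' ≤ ((m' : ℝ) - m) * tauB b (m' - 1) :=
    tau_le b h' (fun j hj => hb (by omega))
  have h2 : tauB b (m - 1) ≤ tauB b (m' - 1) := hb (by omega)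
  have h3 : (n : ℝ) < m := by exact_mod_cast h
  have : ((m : ℝ) - n) * tauB b (m - 1) ≤ ((m : ℝ) - n) * tauB b (m' - 1) :=
    mul_le_mul_of_nonneg_left h2 (by linarith)
  linarith

/-- The greedy selection of lines. -/
lemma greedy (b : ℕ → ℝ) (hb : Monotone (tauB b))
    (hex : ∀ n, ∃ m, n < m ∧ 1 ≤ bA b n m ∧ 1 ≤ bB b n m) :
    ∃ s : ℕ → ℕ, s 0 = 0 ∧ StrictMono s ∧
      (∀ i, 1 ≤ bA b (s i) (s (i + 2)) ∧ 1 ≤ bB b (s i) (s (i + 2))) ∧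
      (∀ i, s (i + 1) = s i + 1 ∨ bA b (s i) (s (i + 1)) < 1 ∨ bB b (s i) (s (i + 1)) < 1) := by
  classical
  let mm : ℕ → ℕ := fun n => Nat.find (hex n)
  have hmm : ∀ n, n < mm n ∧ 1 ≤ bA b n (mm n) ∧ 1 ≤ bB b n (mm n) := fun n => Nat.find_spec (hex n)
  have hmin : ∀ n m, m < mm n → ¬ (n < m ∧ 1 ≤ bA b n m ∧ 1 ≤ bB b n m) :=
    fun n m h => Nat.find_min (hex n) h
  let nx : ℕ → ℕ := fun n => max (n + 1) (mm n - 1)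
  let s : ℕ → ℕ := fun i => Nat.rec 0 (fun _ x => nx x) i
  have hs : ∀ i, s (i + 1) = nx (s i) := fun i => rfl
  have hs00 : s 0 = 0 := rfl
  clear_value s
  have hsm : StrictMono s := strictMono_nat_of_lt_succ (fun i => by
    rw [hs]; exact lt_of_lt_of_le (Nat.lt_succ_self _) (le_max_left _ _))
  refine ⟨s, hs00, hsm, ?_, ?_⟩
  · intro i
    obtain ⟨h1, h2, h3⟩ := hmm (s i)
    have h4 : mm (s i) ≤ s (i + 2) := by
      have h5 : s (i + 1) < s (i + 2) := hsm (by omega)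
      have h6 : mm (s i) - 1 ≤ s (i + 1) := by rw [hs]; exact le_max_right _ _
      omega
    exact ⟨h2.trans (bA_mono b hb h1.le h4), h3.trans (bB_mono b hb h1 h4)⟩
  · intro i
    by_cases h : mm (s i) - 1 ≤ s i + 1
    · left; rw [hs]; exact max_eq_left h
    · right
      push Not at h
      have h2 : s (i + 1) = mm (s i) - 1 := by rw [hs]; exact max_eq_right h.le
      have h3 := hmin (s i) (s (i + 1)) (by omega)
      by_contra hc
      push Not at hc
      exact h3 ⟨by omega, hc⟩

lemma two_step_fin (u : ℕ → ℝ) (L : ℝ) (N : ℕ) (h0 : ∀ p ≤ N, u p ≤ L)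
    (h : ∀ p, p + 2 ≤ N → u (p + 2) ≤ u p - 1) :
    ∀ p ≤ N, u p ≤ L - ((p : ℝ) - 1) / 2 := by
  intro p
  induction p using Nat.strong_induction_on with
  | _ p ih =>
    intro hP
    match p, ih, hP with
    | 0, _, hP => have := h0 0 hP; simp; linarith
    | 1, _, hP => have := h0 1 hP; simp; linarith
    | p + 2, ih, hP =>
      have := h p hP
      have := ih p (by omega) (by omega)
      push_cast
      linarith

lemma dominance (b : ℕ → ℝ) (hb : Monotone (tauB b)) (s : ℕ → ℕ) (hs0 : s 0 = 0)
    (hsm : StrictMono s)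
    (h2 : ∀ i, 1 ≤ bA b (s i) (s (i + 2)) ∧ 1 ≤ bB b (s i) (s (i + 2)))
    (h3 : ∀ i, s (i + 1) = s i + 1 ∨ bA b (s i) (s (i + 1)) < 1 ∨ bB b (s i) (s (i + 1)) < 1)
    (P : ℕ → Prop) (hPd : ∀ m m', m ≤ m' → P m' → P m) (t : ℝ) (k : ℕ) (hk : P k)
    (hup : ∀ m, k < m → P m → t ≤ tauB b k) (hdown : ∀ m < k, tauB b m ≤ t)
    (hP : ∀ i, s i < k → k < s (i + 1) → P (s (i + 1))) :
    ∃ i1, P (s i1) ∧ k * t + b k - 1 ≤ s i1 * t + b (s i1) ∧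
      ∀ i, P (s i) → s i * t + b (s i) ≤ k * t + b k - |(i : ℝ) - i1| / 2 + 3 / 2 := by
  classical
  -- the maximum
  have hmax : ∀ m, P m → m * t + b m ≤ k * t + b k := by
    intro m hm
    rcases le_or_gt m k with h | h
    · have := tau_le b h hdown
      nlinarith
    · have := tau_ge b hb h.le (hup m h hm)
      nlinarith
  obtain ⟨i0, hi0, hi0'⟩ : ∃ i0, s i0 ≤ k ∧ k < s (i0 + 1) := by
    have hex : ∃ i, k < s i := ⟨k + 1, lt_of_lt_of_le (Nat.lt_succ_self k) (hsm.id_le _)⟩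
    have h := Nat.find_spec hex
    have hne : Nat.find hex ≠ 0 := by
      intro h0; rw [h0, hs0] at h; omega
    refine ⟨Nat.find hex - 1, ?_, ?_⟩
    · have := Nat.find_min hex (show Nat.find hex - 1 < Nat.find hex by omega)
      omega
    · rwa [Nat.sub_add_cancel (by omega)]
  -- bound relative to i0
  have hbd : ∀ i, P (s i) → s i * t + b (s i) ≤ k * t + b k - |(i : ℝ) - i0| / 2 + 1 := by
    intro i hi
    rcases le_or_gt i i0 with hle | hgt
    · have key := two_step_fin (fun p => s (i0 - p) * t + b (s (i0 - p))) (k * t + b k) i0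
        (fun p hp => hmax _ (hPd _ k ((hsm.monotone (by omega)).trans hi0) hk)) (by
          intro p hp
          obtain ⟨q, hq⟩ : ∃ q, i0 - (p + 2) = q := ⟨_, rfl⟩
          have hq2 : i0 - p = q + 2 := by omega
          simp only [hq, hq2]
          have hB := (h2 q).2
          have hlt : s q < s (q + 2) := hsm (by omega)
          have hle : s (q + 2) ≤ k := (hsm.monotone (by omega)).trans hi0
          have ht := hdown (s (q + 2) - 1) (by omega)
          unfold bB at hB
          have hlt' : (s q : ℝ) < s (q + 2) := by exact_mod_cast hlt
          nlinarith [mul_nonneg (sub_nonneg.2 hlt'.le) (sub_nonneg.2 ht)])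
        (i0 - i) (by omega)
      simp only [show i0 - (i0 - i) = i by omega] at key
      have : |(i : ℝ) - i0| = ((i0 - i : ℕ) : ℝ) := by
        rw [Nat.cast_sub hle, abs_sub_comm, abs_of_nonneg]
        have : (i : ℝ) ≤ i0 := by exact_mod_cast hle
        linarith
      rw [this]; linarith
    · have hd : ∀ p, P (s (i0 + 1 + p)) → t ≤ tauB b (s (i0 + 1 + p)) := by
        intro p hp
        have hlt : k < s (i0 + 1 + p) := lt_of_lt_of_le hi0' (hsm.monotone (by omega))
        exact (hup _ hlt hp).trans (hb hlt.le)
      obtain ⟨p, rfl⟩ := Nat.exists_eq_add_of_le (show i0 + 1 ≤ i from hgt)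
      have key : ∀ p, P (s (i0 + 1 + p)) →
          s (i0 + 1 + p) * t + b (s (i0 + 1 + p)) ≤ k * t + b k - ((p : ℝ) - 1) / 2 := by
        intro p
        induction p using Nat.strong_induction_on with
        | _ p ih =>
          intro hPp
          match p, ih, hPp with
          | 0, _, hPp => have := hmax _ hPp; simp at this ⊢; linarith
          | 1, _, hPp => have := hmax _ hPp; simp at this ⊢; linarith
          | p + 2, ih, hPp =>
            have hlt : s (i0 + 1 + p) < s (i0 + 1 + p + 2) := hsm (by omega)
            have hPp' : P (s (i0 + 1 + p)) := hPd _ _ hlt.le hPp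
            have h5 := ih p (by omega) hPp'
            have h6 := (h2 (i0 + 1 + p)).1
            have h7 := hd p hPp'
            unfold bA at h6
            have hlt' : (s (i0 + 1 + p) : ℝ) < s (i0 + 1 + p + 2) := by exact_mod_cast hlt
            rw [show i0 + 1 + (p + 2) = i0 + 1 + p + 2 by ring]
            push_cast
            nlinarith [mul_nonneg (sub_nonneg.2 hlt'.le) (sub_nonneg.2 h7)]
      have h8 := key p hi
      have : |((i0 + 1 + p : ℕ) : ℝ) - i0| = p + 1 := by
        push_cast
        rw [abs_of_nonneg] <;> [ring; (have : (0:ℝ) ≤ p := p.cast_nonneg; linarith)]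
      rw [this]; linarith
  -- choose i1
  have fin : ∀ i1 : ℕ, |(i1 : ℝ) - i0| ≤ 1 → P (s i1) → k * t + b k - 1 ≤ s i1 * t + b (s i1) →
    ∃ i1, P (s i1) ∧ k * t + b k - 1 ≤ s i1 * t + b (s i1) ∧
      ∀ i, P (s i) → s i * t + b (s i) ≤ k * t + b k - |(i : ℝ) - i1| / 2 + 3 / 2 := by
    intro i1 h1 h2 h3
    refine ⟨i1, h2, h3, fun i hi => ?_⟩
    have := hbd i hi
    have h4 := abs_sub_le (i : ℝ) i0 i1
    rw [abs_sub_comm (i0 : ℝ)] at h4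
    linarith
  have hPi0 : P (s i0) := hPd _ _ hi0 hk
  rcases hi0.eq_or_lt with heq | hlt
  · exact fin i0 (by simp) hPi0 (by rw [heq]; linarith)
  rcases h3 i0 with h | h | h
  · omega
  · refine fin (i0 + 1) (by simp) (hP _ hlt hi0') ?_
    unfold bA at h
    have h5 := tau_ge b hb hlt.le (le_refl (tauB b (s i0)))
    have h6 : tauB b (s i0) ≤ t := hdown _ hlt
    have h7 : (k : ℝ) < s (i0 + 1) := by exact_mod_cast hi0'
    nlinarith [mul_nonneg (sub_nonneg.2 h7.le) (sub_nonneg.2 h6)]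
  · refine fin i0 (by simp) hPi0 ?_
    unfold bB at h
    have hPn := hP _ hlt hi0'
    have h5 : t ≤ tauB b k := hup _ hi0' hPn
    have h6 : tauB b k ≤ tauB b (s (i0 + 1) - 1) := hb (by omega)
    have h7 := tau_ge b hb hi0'.le (le_refl (tauB b k))
    have h8 : b k - b (s (i0 + 1)) ≤ ((s (i0 + 1) : ℝ) - k) * tauB b (s (i0 + 1) - 1) :=
      tau_le b hi0'.le (fun j hj => hb (by omega))
    have h9 : (s i0 : ℝ) < k := by exact_mod_cast hlt
    nlinarith [mul_nonneg (sub_nonneg.2 h9.le) (sub_nonneg.2 (h5.trans h6))]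

lemma exp_tail (c : ℝ) (hc : 0 < c) : ∃ S : ℝ, 0 < S ∧ ∀ i1 : ℕ,
    Summable (fun i : ℕ => Real.exp (-(c * |(i : ℝ) - i1|))) ∧
    ∑' i : ℕ, Real.exp (-(c * |(i : ℝ) - i1|)) ≤ S := by
  have hnat : Summable (fun n : ℕ => Real.exp (-(c * n))) := by
    have := Real.summable_exp_nat_mul_iff.2 (neg_lt_zero.2 hc)
    refine this.congr (fun n => ?_)
    ring_nf
  have hZ : Summable (fun n : ℤ => Real.exp (-(c * |(n : ℝ)|))) := by
    apply Summable.of_nat_of_neg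
    · simpa using hnat
    · simpa using hnat
  have hinj : ∀ i1 : ℕ, Function.Injective (fun i : ℕ => (i : ℤ) - i1) := by
    intro i1 a b h
    simpa using h
  refine ⟨∑' n : ℤ, Real.exp (-(c * |(n : ℝ)|)), hZ.tsum_pos (fun _ => (Real.exp_pos _).le) 0 (Real.exp_pos _), fun i1 => ?_⟩
  have h1 := hZ.comp_injective (hinj i1)
  have h2 := tsum_comp_le_tsum_of_inj hZ (fun _ => (Real.exp_pos _).le) (hinj i1)
  simp only [Function.comp_def] at h1 h2
  push_cast at h1 h2
  exact ⟨h1, h2⟩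

lemma sieve (K κ c0 C0 : ℝ) (hK : 0 < K) (hκ : 0 < κ) (hc0 : 0 < c0) (hC0 : 0 < C0) :
    ∃ q : ℕ, 0 < q ∧ ∃ c C : ℝ, 0 < c ∧ 0 < C ∧ ∀ (J : ℕ) (Q : ℕ → Fin J → ℂ) (g : ℕ → ℝ) (W : ℝ)
      (i1 : ℕ), 0 ≤ W → κ * W ≤ g i1 →
      (∀ i, g i ≤ K * Real.exp (-|(i : ℝ) - i1| / 2) * W) →
      (∀ i, c0 * g i ≤ ∑ j, ‖Q i j‖ ∧ ∑ j, ‖Q i j‖ ≤ C0 * g i) →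
      c * W ≤ ∑ l : Fin q, ∑ j, ‖∑' i, if i % q = l then Q i j else 0‖ ∧
      ∑ l : Fin q, ∑ j, ‖∑' i, if i % q = l then Q i j else 0‖ ≤ C * W := by
  classical
  obtain ⟨S, hS, hS1⟩ := exp_tail (1/2) (by norm_num)
  obtain ⟨T, hT, hT1⟩ := exp_tail (1/4) (by norm_num)
  obtain ⟨q, hq⟩ : ∃ q : ℕ, C0 * K * T * Real.exp (-(q : ℝ) / 4) ≤ c0 * κ / 2 := by
    have h1 : Filter.Tendsto (fun q : ℕ => C0 * K * T * Real.exp (-(q : ℝ) / 4)) Filter.atTop (nhds (C0 * K * T * 0)) := by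
      apply Filter.Tendsto.const_mul
      apply Real.tendsto_exp_atBot.comp
      have : Filter.Tendsto (fun q : ℕ => (q : ℝ) * (-(1 / 4))) Filter.atTop Filter.atBot :=
        Filter.Tendsto.atTop_mul_const_of_neg (by norm_num) tendsto_natCast_atTop_atTop
      refine this.congr (fun q => by ring)
    rw [mul_zero] at h1
    exact ((h1.eventually (ge_mem_nhds (show (0:ℝ) < c0 * κ / 2 by positivity))).exists)
  have hq' : C0 * K * T * Real.exp (-((q + 1 : ℕ) : ℝ) / 4) ≤ c0 * κ / 2 := by
    refine le_trans ?_ hq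
    gcongr
    simp
  set r := q + 1 with hr
  have hrpos : 0 < r := by omega
  refine ⟨r, hrpos, c0 * κ / 2, r * (C0 * K * S), by positivity, by positivity, ?_⟩
  intro J Q g W i1 hW hi1 hg hQ
  have hQs : ∀ i, ∑ j, ‖Q i j‖ ≤ C0 * K * W * Real.exp (-(1/2 * |(i : ℝ) - i1|)) := by
    intro i
    refine (hQ i).2.trans ?_
    have := mul_le_mul_of_nonneg_left (hg i) hC0.le
    refine this.trans (le_of_eq ?_)
    rw [show -|(i : ℝ) - i1| / 2 = -(1/2 * |(i : ℝ) - i1|) by ring]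
    ring
  have hQj : ∀ i j, ‖Q i j‖ ≤ ∑ j, ‖Q i j‖ := fun i j =>
    Finset.single_le_sum (f := fun j => ‖Q i j‖) (fun _ _ => norm_nonneg _) (Finset.mem_univ j)
  have hsumE := ((hS1 i1).1).mul_left (C0 * K * W)
  have hsumQ : Summable (fun i => ∑ j, ‖Q i j‖) :=
    Summable.of_nonneg_of_le (fun i => Finset.sum_nonneg (fun _ _ => norm_nonneg _)) hQs hsumE
  have hsumQj : ∀ j, Summable (fun i => ‖Q i j‖) := fun j =>
    Summable.of_nonneg_of_le (fun i => norm_nonneg _) (fun i => hQj i j) hsumQ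
  have hite : ∀ (p : ℕ → Prop) [DecidablePred p] (j), Summable (fun i => ‖(if p i then Q i j else 0 : ℂ)‖) := by
    intro p _ j
    refine Summable.of_nonneg_of_le (fun i => norm_nonneg _) (fun i => ?_) (hsumQj j)
    split_ifs <;> simp
  constructor
  · let l0 : Fin r := ⟨i1 % r, Nat.mod_lt _ hrpos⟩
    have h1 : ∑ j, ‖∑' i, if i % r = (l0 : ℕ) then Q i j else 0‖ ≤
        ∑ l : Fin r, ∑ j, ‖∑' i, if i % r = l then Q i j else 0‖ :=
      Finset.single_le_sum (f := fun l : Fin r => ∑ j, ‖∑' i, if i % r = (l : ℕ) then Q i j else 0‖)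
        (fun _ _ => Finset.sum_nonneg (fun _ _ => norm_nonneg _)) (Finset.mem_univ l0)
    refine le_trans ?_ h1
    have h2 : ∀ j, ‖Q i1 j‖ - ∑' i, (if i % r = i1 % r ∧ i ≠ i1 then ‖Q i j‖ else 0) ≤
        ‖∑' i, if i % r = (l0 : ℕ) then Q i j else 0‖ := by
      intro j
      have hs : Summable (fun i => if i % r = (l0 : ℕ) then Q i j else 0) := (hite _ j).of_norm
      rw [hs.tsum_eq_add_tsum_ite i1]
      have h3 : ‖∑' i, (if i = i1 then 0 else if i % r = (l0 : ℕ) then Q i j else 0)‖ ≤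
          ∑' i, (if i % r = i1 % r ∧ i ≠ i1 then ‖Q i j‖ else 0) := by
        refine (norm_tsum_le_tsum_norm ?_).trans (le_of_eq ?_)
        · refine Summable.of_nonneg_of_le (fun i => norm_nonneg _) (fun i => ?_) (hsumQj j)
          split_ifs <;> simp
        · congr 1
          ext i
          by_cases h : i = i1 <;> by_cases h' : i % r = i1 % r <;> simp [h, h', l0]
      have h4 : (if i1 % r = (l0 : ℕ) then Q i1 j else 0) = Q i1 j := if_pos rfl
      rw [h4]
      have := norm_sub_le_norm_add (Q i1 j) (∑' i, (if i = i1 then 0 else if i % r = (l0 : ℕ) then Q i j else 0))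
      linarith
    have h5 := Finset.sum_le_sum (s := Finset.univ) (fun j _ => h2 j)
    refine le_trans ?_ h5
    rw [Finset.sum_sub_distrib, ← Summable.tsum_finsetSum]
    swap
    · intro j _
      refine Summable.of_nonneg_of_le (fun i => ?_) (fun i => ?_) (hsumQj j)
      · split_ifs <;> simp
      · split_ifs <;> simp
    have h6 : ∑' i, ∑ j, (if i % r = i1 % r ∧ i ≠ i1 then ‖Q i j‖ else 0) ≤
        ∑' i : ℕ, C0 * K * W * Real.exp (-(r : ℝ) / 4) * Real.exp (-(1/4 * |(i : ℝ) - i1|)) := by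
      have hb : ∀ i, ∑ j, (if i % r = i1 % r ∧ i ≠ i1 then ‖Q i j‖ else 0) ≤
          C0 * K * W * Real.exp (-(r : ℝ) / 4) * Real.exp (-(1/4 * |(i : ℝ) - i1|)) := by
        intro i
        by_cases h : i % r = i1 % r ∧ i ≠ i1
        · simp only [if_pos h]
          refine (hQs i).trans ?_
          rw [mul_assoc (C0 * K * W), ← Real.exp_add]
          have hd : (r : ℝ) ≤ |(i : ℝ) - i1| := by
            have hdvd : (r : ℤ) ∣ (i : ℤ) - i1 := by
              have := (Nat.modEq_iff_dvd (n := r) (a := i1) (b := i)).1 h.1.symm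
              exact this
            have := Int.le_of_dvd (abs_pos.2 (sub_ne_zero.2 (by exact_mod_cast h.2))) ((dvd_abs _ _).2 hdvd)
            exact_mod_cast this
          gcongr
          linarith
        · simp only [if_neg h, Finset.sum_const_zero]
          positivity
      refine Summable.tsum_le_tsum hb ?_ ((hT1 i1).1.mul_left _)
      refine Summable.of_nonneg_of_le (fun i => Finset.sum_nonneg (fun j _ => ?_)) hb ((hT1 i1).1.mul_left _)
      split_ifs <;> simp
    rw [tsum_mul_left] at h6
    have h7 := (hQ i1).1
    have h8 : C0 * K * W * Real.exp (-(r : ℝ) / 4) * ∑' i : ℕ, Real.exp (-(1/4 * |(i : ℝ) - i1|)) ≤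
      C0 * K * W * Real.exp (-(r : ℝ) / 4) * T := mul_le_mul_of_nonneg_left (hT1 i1).2 (by positivity)
    have h9 : C0 * K * W * Real.exp (-(r : ℝ) / 4) * T ≤ c0 * κ / 2 * W := by
      have := mul_le_mul_of_nonneg_right hq' hW
      linarith
    have h10 : c0 * (κ * W) ≤ c0 * g i1 := mul_le_mul_of_nonneg_left hi1 hc0.le
    linarith
  · have h1 : ∀ l : Fin r, ∑ j, ‖∑' i, if i % r = (l : ℕ) then Q i j else 0‖ ≤ C0 * K * S * W := by
      intro l
      have h2 : ∀ j, ‖∑' i, if i % r = (l : ℕ) then Q i j else 0‖ ≤ ∑' i, ‖Q i j‖ := by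
        intro j
        refine (norm_tsum_le_tsum_norm (hite _ j)).trans ?_
        refine Summable.tsum_le_tsum (fun i => ?_) (hite _ j) (hsumQj j)
        split_ifs <;> simp
      refine (Finset.sum_le_sum (fun j _ => h2 j)).trans ?_
      rw [← Summable.tsum_finsetSum (fun j _ => hsumQj j)]
      refine (Summable.tsum_le_tsum hQs hsumQ hsumE).trans ?_
      rw [tsum_mul_left]
      have := mul_le_mul_of_nonneg_left (hS1 i1).2 (show 0 ≤ C0 * K * W by positivity)
      linarith
    refine (Finset.sum_le_sum (fun l _ => h1 l)).trans (le_of_eq ?_)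
    simp
    ring

lemma finite_greedy (N : ℕ) (β : ℕ → ℝ) (hβ : ∀ a, a + 2 ≤ N → tauB β a ≤ tauB β (a + 1)) :
    ∃ s : ℕ → ℕ, StrictMono s ∧ ∀ t : ℝ, ∃ k ≤ N, (∀ m ≤ N, m * t + β m ≤ k * t + β k) ∧
      ∃ i1, s i1 ≤ N ∧ k * t + β k - 1 ≤ s i1 * t + β (s i1) ∧
      ∀ i, s i ≤ N → s i * t + β (s i) ≤ k * t + β k - |(i : ℝ) - i1| / 2 + 3 / 2 := by
  classical
  set M : ℝ := β (N - 1) - β N + 1 with hM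
  let b : ℕ → ℝ := fun a => if a ≤ N then β a else
    β N - (((a : ℝ) - N) * M + ((a : ℝ) - N) * ((a : ℝ) - N - 1) / 2)
  have hbN : ∀ a ≤ N, b a = β a := fun a ha => if_pos ha
  have hbN' : ∀ a, N ≤ a → b a = β N - (((a : ℝ) - N) * M + ((a : ℝ) - N) * ((a : ℝ) - N - 1) / 2) := by
    intro a ha
    rcases ha.eq_or_lt with h | h
    · subst h; rw [hbN _ le_rfl]; simp
    · exact if_neg (by omega)
  have ht1 : ∀ a < N, tauB b a = tauB β a := by
    intro a ha
    unfold tauB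
    rw [hbN a ha.le, hbN _ ha]
  have ht2 : ∀ a, N ≤ a → tauB b a = M + ((a : ℝ) - N) := by
    intro a ha
    unfold tauB
    rw [hbN' a ha, hbN' (a + 1) (by omega)]
    push_cast; ring
  have hstep : ∀ a, N ≤ a + 1 → tauB b a + 1 ≤ tauB b (a + 1) := by
    intro a ha
    rcases ha.eq_or_lt with h | h
    · rw [ht1 a (by omega), ht2 (a + 1) (by omega), hM]
      unfold tauB
      rw [h]; simp
    · rw [ht2 a (by omega), ht2 (a + 1) (by omega)]
      push_cast; linarith
  have hmono : Monotone (tauB b) := by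
    apply monotone_nat_of_le_succ
    intro a
    by_cases h : a + 2 ≤ N
    · rw [ht1 a (by omega), ht1 (a + 1) (by omega)]
      exact hβ a h
    · have := hstep a (by omega)
      linarith
  have hAB : ∀ n m, n < m → N ≤ m → 1 ≤ bA b n (m + 1) ∧ 1 ≤ bB b n (m + 1) := by
    intro n m hnm hm
    obtain ⟨p, rfl⟩ : ∃ p, m = p + 1 := ⟨m - 1, by omega⟩
    have h1 := hstep p hm
    have h2 : tauB b n ≤ tauB b p := hmono (by omega)
    constructor
    · have h3 := tau_ge b hmono (show n ≤ p + 1 by omega) (le_refl (tauB b n))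
      have h4 : tauB b (p + 1) = b (p + 1) - b (p + 1 + 1) := rfl
      unfold bA
      push_cast at h3 ⊢
      linarith
    · have h3 : b n - b (p + 1) ≤ (((p + 1 : ℕ) : ℝ) - n) * tauB b p :=
        tau_le b (show n ≤ p + 1 by omega) (fun j hj => hmono (by omega))
      have h4 : tauB b (p + 1) = b (p + 1) - b (p + 1 + 1) := rfl
      unfold bB
      simp only [Nat.add_sub_cancel]
      have h5 : (n : ℝ) ≤ p := by exact_mod_cast (show n ≤ p by omega)
      push_cast at h3 ⊢
      nlinarith [mul_nonneg (sub_nonneg.2 h5) (sub_nonneg.2 (show (1:ℝ) ≤ tauB b (p+1) - tauB b p by linarith))]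
  obtain ⟨s, hs0, hsm, h2, h3⟩ := greedy b hmono (fun n => ⟨max (n + 1) N + 1, by omega,
    hAB n (max (n + 1) N) (by omega) (le_max_right _ _)⟩)
  refine ⟨s, hsm, fun t => ?_⟩
  obtain ⟨k, hkN, hup, hdown⟩ : ∃ k ≤ N, (k < N → t ≤ tauB b k) ∧ ∀ m < k, tauB b m ≤ t := by
    by_cases hex : ∃ k, k < N ∧ t ≤ tauB b k
    · refine ⟨Nat.find hex, (Nat.find_spec hex).1.le, fun _ => (Nat.find_spec hex).2, fun m hm => ?_⟩
      have h := Nat.find_min hex hm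
      have := (Nat.find_spec hex).1
      by_contra hc
      exact h ⟨by omega, (not_le.1 hc).le⟩
    · push Not at hex
      exact ⟨N, le_rfl, fun h => absurd h (lt_irrefl _), fun m hm => (hex m hm).le⟩
  refine ⟨k, hkN, ?_, ?_⟩
  · intro m hm
    rw [← hbN m hm, ← hbN k hkN]
    rcases le_or_gt m k with h | h
    · have := tau_le b h hdown
      nlinarith
    · have := tau_ge b hmono h.le (hup (by omega))
      nlinarith
  · obtain ⟨i1, h4, h5, h6⟩ := dominance b hmono s hs0 hsm h2 h3 (fun m => m ≤ N) (fun m m' h h' => h.trans h') t k hkN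
      (fun m hm hmN => hup (by omega)) hdown (by
        intro i hi hi'
        by_contra hc
        have hAB' := hAB (s i) N (by omega) le_rfl
        have h7 := bA_mono b hmono (show s i ≤ N + 1 by omega) (show N + 1 ≤ s (i + 1) by omega)
        have h8 := bB_mono b hmono (show s i < N + 1 by omega) (show N + 1 ≤ s (i + 1) by omega)
        rcases h3 i with h | h | h
        · omega
        · linarith [hAB'.1]
        · linarith [hAB'.2])
    refine ⟨i1, h4, ?_, ?_⟩
    · rw [← hbN k hkN, ← hbN _ h4]; exact h5
    · intro i hi
      rw [← hbN k hkN, ← hbN _ hi]; exact h6 i hi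

/-- entropy function -/
def entH (N a : ℕ) (θ : ℝ) : ℝ := a * Real.log θ + ((N : ℝ) - a) * Real.log (1 - θ)

lemma mul_log_div_le (x y c : ℝ) (hx : 0 < x) (hy : 0 < y) (hc : 0 ≤ c) :
    c * Real.log x ≤ c * Real.log y + c * (x / y - 1) := by
  have h := Real.log_le_sub_one_of_pos (div_pos hx hy)
  rw [Real.log_div hx.ne' hy.ne'] at h
  nlinarith

lemma entH_le (N a : ℕ) (ha : a ≤ N) (θ : ℝ) (h0 : 0 < θ) (h1 : θ < 1) :
    entH N a θ ≤ entH N a ((a : ℝ) / N) := by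
  rcases Nat.eq_zero_or_pos N with rfl | hN
  · have : a = 0 := by omega
    subst this; simp [entH]
  have hN' : (0:ℝ) < N := by exact_mod_cast hN
  have haN : (a : ℝ) ≤ N := by exact_mod_cast ha
  unfold entH
  have e1 : (a : ℝ) * Real.log θ ≤ a * Real.log (a / N) + (N * θ - a) := by
    rcases Nat.eq_zero_or_pos a with rfl | hap
    · simp; positivity
    have hap' : (0:ℝ) < a := by exact_mod_cast hap
    have := mul_log_div_le θ (a / N) a h0 (by positivity) (by positivity)
    refine this.trans (le_of_eq ?_)
    field_simp
  have e2 : ((N : ℝ) - a) * Real.log (1 - θ) ≤ (N - a) * Real.log (1 - a / N) + (a - N * θ) := by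
    rcases haN.eq_or_lt with h | h
    · rw [h]; simp; nlinarith
    have hap' : (0:ℝ) < (N - a) / N := div_pos (by linarith) hN'
    have := mul_log_div_le (1 - θ) ((N - a) / N) (N - a) (by linarith) hap' (by linarith)
    have e : (1 - (a : ℝ) / N) = (N - a) / N := by field_simp
    rw [e]
    refine this.trans (le_of_eq ?_)
    have : (N : ℝ) - a ≠ 0 := by linarith
    field_simp
    ring
  linarith

lemma entH_ge (N : ℕ) (θ : ℝ) (h0 : 0 < θ) (h1 : θ < 1) :
    ∃ a ≤ N, entH N a ((a : ℝ) / N) ≤ entH N a θ + 2 := by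
  rcases Nat.eq_zero_or_pos N with rfl | hN
  · exact ⟨0, le_rfl, by simp [entH]⟩
  have hN' : (0:ℝ) < N := by exact_mod_cast hN
  -- general estimate
  have key : ∀ a ≤ N, (N : ℝ) * ((a : ℝ) / N - θ)^2 ≤ 2 * (θ * (1 - θ)) →
      entH N a ((a : ℝ) / N) ≤ entH N a θ + 2 := by
    intro a ha hh
    have haN : (a : ℝ) ≤ N := by exact_mod_cast ha
    have e1 : (a : ℝ) * Real.log (a / N) ≤ a * Real.log θ + a * (a / N / θ - 1) := by
      rcases Nat.eq_zero_or_pos a with rfl | hap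
      · simp
      have hap' : (0:ℝ) < a := by exact_mod_cast hap
      exact mul_log_div_le (a / N) θ a (by positivity) h0 (by positivity)
    have e2 : ((N : ℝ) - a) * Real.log (1 - a / N) ≤ (N - a) * Real.log (1 - θ) +
        (N - a) * ((1 - a / N) / (1 - θ) - 1) := by
      rcases haN.eq_or_lt with h | h
      · rw [h]; simp
      refine mul_log_div_le (1 - a / N) (1 - θ) (N - a) ?_ (by linarith) (by linarith)
      rw [sub_pos, div_lt_one hN']; exact h
    have e3 : (a : ℝ) * (a / N / θ - 1) + (N - a) * ((1 - a / N) / (1 - θ) - 1) =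
        N * ((a : ℝ) / N - θ)^2 / (θ * (1 - θ)) := by
      have : 1 - θ ≠ 0 := by linarith
      field_simp
      ring
    have e4 : (N : ℝ) * ((a : ℝ) / N - θ)^2 / (θ * (1 - θ)) ≤ 2 := by
      rw [div_le_iff₀ (mul_pos h0 (by linarith))]; exact hh
    unfold entH
    linarith
  have hsq : ∀ a : ℕ, (N : ℝ) * ((a : ℝ) / N - θ)^2 = (a - N * θ)^2 / N := by
    intro a; field_simp
  rcases le_or_gt θ (1/2) with hθ | hθ
  · refine ⟨⌊(N : ℝ) * θ⌋₊, ?_, key _ ?_ ?_⟩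
    · apply Nat.floor_le_of_le; nlinarith
    · apply Nat.floor_le_of_le; nlinarith
    · rw [hsq, div_le_iff₀ hN']
      have f1 := Nat.floor_le (show 0 ≤ (N : ℝ) * θ by positivity)
      have f2 := Nat.lt_floor_add_one ((N : ℝ) * θ)
      have f3 : (0:ℝ) ≤ ⌊(N : ℝ) * θ⌋₊ := Nat.cast_nonneg _
      set f : ℝ := ((⌊(N : ℝ) * θ⌋₊ : ℕ) : ℝ)
      have g1 : (f - N * θ)^2 ≤ N * θ := by
        have : (N * θ - f) ≤ 1 := by linarith
        have : (N * θ - f) ≤ N * θ := by linarith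
        nlinarith
      have : 0 < N * θ := by positivity
      nlinarith
  · refine ⟨⌈(N : ℝ) * θ⌉₊, ?_, key _ ?_ ?_⟩
    · apply Nat.ceil_le.2; nlinarith
    · apply Nat.ceil_le.2; nlinarith
    · rw [hsq, div_le_iff₀ hN']
      have f1 := Nat.le_ceil ((N : ℝ) * θ)
      have f2 := Nat.ceil_lt_add_one (show 0 ≤ (N : ℝ) * θ by positivity)
      have f3 : ((⌈(N : ℝ) * θ⌉₊ : ℕ) : ℝ) ≤ N := by
        exact_mod_cast (Nat.ceil_le.2 (by nlinarith) : ⌈(N : ℝ) * θ⌉₊ ≤ N)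
      set f : ℝ := ((⌈(N : ℝ) * θ⌉₊ : ℕ) : ℝ)
      have g1 : (f - N * θ)^2 ≤ N * (1 - θ) := by
        have : f - N * θ ≤ 1 := by linarith
        have : f - N * θ ≤ N * (1 - θ) := by linarith
        nlinarith
      have : 0 < N * (1 - θ) := mul_pos hN' (by linarith)
      nlinarith

lemma poly_weights (N : ℕ) : ∃ (s : ℕ → ℕ) (γ : ℕ → ℝ), StrictMono s ∧ (∀ i, 0 ≤ γ i) ∧
    ∀ x y : ℝ, 0 < x → 0 < y → ∃ i1,
      Real.exp (-2) * Real.sqrt (x^2 + y^2) ^ N ≤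
        (if s i1 ≤ N then γ i1 * x ^ s i1 * y ^ (N - s i1) else 0) ∧
      ∀ i, (if s i ≤ N then γ i * x ^ s i * y ^ (N - s i) else 0) ≤
        Real.exp 2 * Real.exp (-|(i : ℝ) - i1| / 2) * Real.sqrt (x^2 + y^2) ^ N := by
  let β : ℕ → ℝ := fun a => -(entH N a ((a : ℝ) / N)) / 2
  have hβ : ∀ a, a + 2 ≤ N → tauB β a ≤ tauB β (a + 1) := by
    intro a ha
    have hN : (0:ℝ) < N := by exact_mod_cast (show 0 < N by omega)
    have haN : (a : ℝ) + 2 ≤ N := by exact_mod_cast ha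
    have q0 : (0:ℝ) < ((a + 1 : ℕ) : ℝ) / N := by positivity
    have q1 : ((a + 1 : ℕ) : ℝ) / N < 1 := by rw [div_lt_one hN]; push_cast; linarith
    have h1 := entH_le N a (by omega) _ q0 q1
    have h2 := entH_le N (a + 2) (by omega) _ q0 q1
    have h3 : entH N a (((a + 1 : ℕ) : ℝ) / N) + entH N (a + 2) (((a + 1 : ℕ) : ℝ) / N)
      = 2 * entH N (a + 1) (((a + 1 : ℕ) : ℝ) / N) := by
      unfold entH; push_cast; ring
    show -_ / 2 - -_ / 2 ≤ -_ / 2 - -_ / 2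
    linarith
  obtain ⟨s, hsm, hs⟩ := finite_greedy N β hβ
  refine ⟨s, fun i => Real.exp (β (s i)), hsm, fun i => (Real.exp_pos _).le, ?_⟩
  intro x y hx hy
  set ρ := Real.sqrt (x^2 + y^2) with hρ
  have hρ2 : ρ^2 = x^2 + y^2 := Real.sq_sqrt (by positivity)
  have hρ0 : 0 < ρ := Real.sqrt_pos.2 (by positivity)
  set θ := x^2 / ρ^2 with hθ
  have hθ0 : 0 < θ := by positivity
  have hθ' : 1 - θ = y^2 / ρ^2 := by rw [hθ]; field_simp; linarith
  have hθ1 : θ < 1 := by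
    have : 0 < y^2 / ρ^2 := by positivity
    linarith
  have hent : ∀ a, entH N a θ = 2 * (a * Real.log x + (N - a) * Real.log y - N * Real.log ρ) := by
    intro a
    unfold entH
    rw [hθ', hθ, Real.log_div (by positivity) (by positivity), Real.log_div (by positivity) (by positivity)]
    simp only [Real.log_pow]
    push_cast; ring
  have hg : ∀ i, s i ≤ N → Real.exp (β (s i)) * x ^ s i * y ^ (N - s i) =
      Real.exp (s i * (Real.log x - Real.log y) + β (s i) + N * Real.log y) := by
    intro i hi
    have e1 : x ^ s i = Real.exp (s i * Real.log x) := by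
      rw [Real.exp_nat_mul, Real.exp_log hx]
    have e2 : y ^ (N - s i) = Real.exp (((N : ℝ) - s i) * Real.log y) := by
      rw [← Nat.cast_sub hi, Real.exp_nat_mul, Real.exp_log hy]
    rw [e1, e2, ← Real.exp_add, ← Real.exp_add]
    congr 1; ring
  have hW : ρ ^ N = Real.exp (N * Real.log ρ) := by rw [Real.exp_nat_mul, Real.exp_log hρ0]
  obtain ⟨k, hkN, hmax, i1, hi1, h4, h5⟩ := hs (Real.log x - Real.log y)
  obtain ⟨a, haN, ha⟩ := entH_ge N θ hθ0 hθ1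
  have u1 : k * (Real.log x - Real.log y) + β k + N * Real.log y ≤ N * Real.log ρ := by
    have := entH_le N k hkN θ hθ0 hθ1
    rw [hent k] at this
    show _ + -(entH N k ((k : ℝ) / N)) / 2 + _ ≤ _
    linarith
  have u2 : N * Real.log ρ - 1 ≤ k * (Real.log x - Real.log y) + β k + N * Real.log y := by
    have h := hmax a haN
    rw [hent a] at ha
    have : β a = -(entH N a ((a : ℝ) / N)) / 2 := rfl
    linarith
  refine ⟨i1, ?_, ?_⟩
  · rw [if_pos hi1, hg i1 hi1, hW, ← Real.exp_add]
    apply Real.exp_le_exp.2; linarith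
  · intro i
    split_ifs with hi
    · rw [hg i hi, hW, ← Real.exp_add, ← Real.exp_add]
      apply Real.exp_le_exp.2
      have := h5 i hi
      linarith
    · positivity

/-- Euclidean norm on `ℂ^m`. -/
def cnrm {m : ℕ} (z : Fin m → ℂ) : ℝ := Real.sqrt (∑ k, ‖z k‖ ^ 2)

lemma continuous_cnrm {m : ℕ} : Continuous (cnrm (m := m)) := by
  unfold cnrm; fun_prop

lemma cnrm_succ {m : ℕ} (z : Fin (m + 1) → ℂ) :
    cnrm z = Real.sqrt (cnrm (fun k : Fin m => z k.succ) ^ 2 + ‖z 0‖ ^ 2) := by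
  unfold cnrm
  rw [Real.sq_sqrt (by positivity), Fin.sum_univ_succ, add_comm]

lemma poly_family (m : ℕ) : ∃ (J : ℕ) (c C : ℝ), 0 < c ∧ 0 < C ∧ ∀ n : ℕ,
    ∃ Q : Fin J → (Fin (m + 1) → ℂ) → ℂ, (∀ j, ContDiff ℂ ⊤ (Q j)) ∧
      ∀ z, c * cnrm z ^ n ≤ ∑ j, ‖Q j z‖ ∧ ∑ j, ‖Q j z‖ ≤ C * cnrm z ^ n := by
  classical
  induction m with
  | zero =>
    refine ⟨1, 1, 1, one_pos, one_pos, fun n => ⟨fun _ z => z 0 ^ n, fun j => by fun_prop, fun z => ?_⟩⟩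
    have : cnrm z = ‖z 0‖ := by unfold cnrm; simp
    simp [this]
  | succ m ih =>
    obtain ⟨J, c0, C0, hc0, hC0, hQ⟩ := ih
    choose Q hQd hQb using hQ
    obtain ⟨q, hq, c, C, hc, hC, hsv⟩ := sieve (Real.exp 2) (Real.exp (-2)) c0 C0
      (Real.exp_pos _) (Real.exp_pos _) hc0 hC0
    refine ⟨q * J, c, C, hc, hC, fun N => ?_⟩
    obtain ⟨s, γ, hsm, hγ, hw⟩ := poly_weights N
    let R : ℕ → Fin J → (Fin (m + 2) → ℂ) → ℂ := fun i j z =>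
      if s i ≤ N then (γ i : ℂ) * Q (s i) j (fun k => z k.succ) * z 0 ^ (N - s i) else 0
    have hRd : ∀ i j, ContDiff ℂ ⊤ (R i j) := by
      intro i j
      by_cases h : s i ≤ N
      · have : R i j = fun z => (γ i : ℂ) * Q (s i) j (fun k => z k.succ) * z 0 ^ (N - s i) := by
          funext z; exact if_pos h
        rw [this]
        have h1 : ContDiff ℂ ⊤ (fun z : Fin (m + 2) → ℂ => Q (s i) j (fun k => z k.succ)) :=
          (hQd (s i) j).comp (by fun_prop)
        exact (contDiff_const.mul h1).mul (by fun_prop)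
      · have : R i j = fun z => 0 := by funext z; exact if_neg h
        rw [this]; exact contDiff_const
    let F : Fin q → Fin J → (Fin (m + 2) → ℂ) → ℂ := fun l j z =>
      ∑ i ∈ Finset.range (N + 1), if i % q = l then R i j z else 0
    have hFd : ∀ l j, ContDiff ℂ ⊤ (F l j) := by
      intro l j
      apply ContDiff.sum
      intro i _
      split_ifs
      · exact hRd i j
      · exact contDiff_const
    have hFt : ∀ l j z, F l j z = ∑' i, if i % q = l then R i j z else 0 := by
      intro l j z
      rw [tsum_eq_sum]
      intro i hi
      have h1 : N + 1 ≤ i := by simpa using hi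
      have h2 : i ≤ s i := hsm.id_le i
      have : R i j z = 0 := if_neg (by omega)
      simp [this]
    refine ⟨fun p => F (finProdFinEquiv.symm p).1 (finProdFinEquiv.symm p).2, fun p => hFd _ _, ?_⟩
    have hsum : ∀ z, ∑ p : Fin (q * J), ‖F (finProdFinEquiv.symm p).1 (finProdFinEquiv.symm p).2 z‖ =
        ∑ l, ∑ j, ‖F l j z‖ := by
      intro z
      rw [Equiv.sum_comp finProdFinEquiv.symm (fun p : Fin q × Fin J => ‖F p.1 p.2 z‖), Fintype.sum_prod_type]
    simp only [hsum]
    -- on the dense set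
    have hdense : ∀ z : Fin (m + 2) → ℂ, (∀ k, z k ≠ 0) →
        c * cnrm z ^ N ≤ ∑ l, ∑ j, ‖F l j z‖ ∧ ∑ l, ∑ j, ‖F l j z‖ ≤ C * cnrm z ^ N := by
      intro z hz
      set z' : Fin (m + 1) → ℂ := fun k => z k.succ with hz'
      have hx : 0 < cnrm z' := by
        unfold cnrm
        apply Real.sqrt_pos.2
        apply Finset.sum_pos
        · intro k _
          have := norm_pos_iff.2 (hz k.succ)
          positivity
        · exact Finset.univ_nonempty
      have hy : 0 < ‖z 0‖ := norm_pos_iff.2 (hz 0)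
      obtain ⟨i1, h1, h2⟩ := hw (cnrm z') ‖z 0‖ hx hy
      rw [cnrm_succ z]
      simp only [hFt]
      refine hsv J (fun i j => R i j z) _ _ i1 (by positivity) h1 h2 (fun i => ?_)
      by_cases h : s i ≤ N
      · have hR : ∀ j, ‖R i j z‖ = γ i * ‖z 0‖ ^ (N - s i) * ‖Q (s i) j z'‖ := by
          intro j
          simp only [R, if_pos h, norm_mul, norm_pow, Complex.norm_real, Real.norm_eq_abs, abs_of_nonneg (hγ i)]
          ring
        simp only [hR, if_pos h, ← Finset.mul_sum]
        obtain ⟨h3, h4⟩ := hQb (s i) z'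
        have h5 : 0 ≤ γ i * ‖z 0‖ ^ (N - s i) := mul_nonneg (hγ i) (by positivity)
        have h6 := mul_le_mul_of_nonneg_left h3 h5
        have h7 := mul_le_mul_of_nonneg_left h4 h5
        constructor <;> linarith
      · have hR : ∀ j, R i j z = 0 := fun j => if_neg h
        simp [hR, if_neg h]
    have hD : Dense {z : Fin (m + 2) → ℂ | ∀ k, z k ≠ 0} := by
      have := dense_pi (univ : Set (Fin (m + 2))) (s := fun _ => ({0}ᶜ : Set ℂ)) (fun i _ => dense_compl_singleton 0)
      convert this using 1
      ext z; simp
    have hcont : Continuous (fun z => ∑ l, ∑ j, ‖F l j z‖) := by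
      have := fun l j => (hFd l j).continuous
      fun_prop
    have hcn : Continuous (fun z : Fin (m + 2) → ℂ => cnrm z ^ N) := continuous_cnrm.pow N
    intro z
    have hcl : IsClosed {z : Fin (m + 2) → ℂ | c * cnrm z ^ N ≤ ∑ l, ∑ j, ‖F l j z‖ ∧ ∑ l, ∑ j, ‖F l j z‖ ≤ C * cnrm z ^ N} :=
      (isClosed_le (continuous_const.mul hcn) hcont).inter (isClosed_le hcont (continuous_const.mul hcn))
    have := hcl.closure_subset_iff.2 (fun z hz => hdense z hz : {z : Fin (m + 2) → ℂ | ∀ k, z k ≠ 0} ⊆ _)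
    exact this (hD z)

lemma series_hasFDerivAt {E G : Type} [NormedAddCommGroup E] [NormedSpace ℂ E]
    [NormedAddCommGroup G] [NormedSpace ℂ G] [CompleteSpace G] (f : ℕ → E → G)
    (hf : ∀ i, ContDiff ℂ ⊤ (f i)) (x : E) (δ : ℝ) (hδ : 0 < δ) (u : ℕ → ℝ) (hu : Summable u)
    (hb : ∀ i, ∀ y ∈ ball x δ, ‖f i y‖ ≤ u i) :
    (∀ i, ∀ y ∈ ball x (δ / 2), ‖fderiv ℂ (f i) y‖ ≤ 4 / δ * u i) ∧
    HasFDerivAt (fun y => ∑' i, f i y) (∑' i, fderiv ℂ (f i) x) x := by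
  have hd : ∀ i, Differentiable ℂ (f i) := fun i => (hf i).differentiable (by simp)
  have h1 : ∀ i, ∀ y ∈ ball x (δ / 2), ‖fderiv ℂ (f i) y‖ ≤ 4 / δ * u i := by
    intro i y hy
    have hy' : y ∈ ball x δ := ball_subset_ball (by linarith) hy
    have := Complex.norm_fderiv_le_div_of_mapsTo_ball (f := f i) (c := y) (R₁ := δ / 2) (R₂ := 2 * u i)
      (hd i).differentiableOn (by
        intro z hz
        have hz' : z ∈ ball x δ := by
          rw [mem_ball] at hy hz ⊢
          linarith [dist_triangle z y x]
        rw [mem_closedBall, dist_eq_norm]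
        have := norm_sub_le (f i z) (f i y)
        linarith [hb i z hz', hb i y hy']) (by linarith)
    refine this.trans (le_of_eq ?_)
    field_simp; ring
  refine ⟨h1, ?_⟩
  have hx : x ∈ ball x (δ / 2) := mem_ball_self (by linarith)
  exact hasFDerivAt_tsum_of_isPreconnected (hu.mul_left (4 / δ)) isOpen_ball
    (convex_ball x (δ / 2)).isPreconnected (fun i y _ => (hd i y).hasFDerivAt) h1 hx
    (Summable.of_norm_bounded hu (fun i => hb i x (mem_ball_self hδ))) hx

lemma series_contDiffOn {E : Type} [NormedAddCommGroup E] [NormedSpace ℂ E] (U : Set E) (hU : IsOpen U)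
    (n : ℕ) : ∀ {G : Type} [NormedAddCommGroup G] [NormedSpace ℂ G] [CompleteSpace G] (f : ℕ → E → G)
    (_ : ∀ i, ContDiff ℂ ⊤ (f i))
    (_ : ∀ x ∈ U, ∃ δ > 0, ∃ u : ℕ → ℝ, Summable u ∧ ∀ i, ∀ y ∈ ball x δ, ‖f i y‖ ≤ u i),
    ContDiffOn ℂ n (fun y => ∑' i, f i y) U := by
  induction n with
  | zero =>
    intro G _ _ _ f hf hb
    have : ContinuousOn (fun y => ∑' i, f i y) U := by
      intro x hx
      obtain ⟨δ, hδ, u, hu, h⟩ := hb x hx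
      exact (series_hasFDerivAt f hf x δ hδ u hu h).2.continuousAt.continuousWithinAt
    exact_mod_cast (contDiffOn_zero (𝕜 := ℂ)).2 this
  | succ n ih =>
    intro G _ _ _ f hf hb
    push_cast
    rw [contDiffOn_succ_iff_fderiv_of_isOpen hU]
    refine ⟨?_, by simp, ?_⟩
    · intro x hx
      obtain ⟨δ, hδ, u, hu, h⟩ := hb x hx
      exact (series_hasFDerivAt f hf x δ hδ u hu h).2.differentiableAt.differentiableWithinAt
    · have := ih (fun i => fderiv ℂ (f i)) (fun i => (hf i).fderiv_right (by simp)) (by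
        intro x hx
        obtain ⟨δ, hδ, u, hu, h⟩ := hb x hx
        exact ⟨δ / 2, by linarith, _, hu.mul_left (4 / δ), (series_hasFDerivAt f hf x δ hδ u hu h).1⟩)
      refine this.congr ?_
      intro x hx
      obtain ⟨δ, hδ, u, hu, h⟩ := hb x hx
      exact (series_hasFDerivAt f hf x δ hδ u hu h).2.fderiv

/-- The real-linear identification `ℝ^(2m) → ℂ^m`. -/
def toC (m : ℕ) : EuclideanSpace ℝ (Fin (m + m)) →L[ℝ] (Fin m → ℂ) :=
  ContinuousLinearMap.pi (fun k =>
    Complex.ofRealCLM.comp (EuclideanSpace.proj (Fin.castAdd m k)) +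
    (Complex.I • Complex.ofRealCLM).comp (EuclideanSpace.proj (Fin.natAdd m k)))

lemma toC_apply (m : ℕ) (x : EuclideanSpace ℝ (Fin (m + m))) (k : Fin m) :
    toC m x k = (x (Fin.castAdd m k) : ℂ) + Complex.I * (x (Fin.natAdd m k) : ℂ) := by
  simp [toC]

lemma cnrm_toC (m : ℕ) (x : EuclideanSpace ℝ (Fin (m + m))) : cnrm (toC m x) = ‖x‖ := by
  unfold cnrm
  rw [EuclideanSpace.norm_eq, Fin.sum_univ_add, ← Finset.sum_add_distrib]
  congr 1
  apply Finset.sum_congr rfl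
  intro k _
  rw [toC_apply, ← Complex.normSq_eq_norm_sq, Complex.normSq_apply]
  simp
  ring

lemma toC_single (m : ℕ) (k : Fin m) :
    toC m (EuclideanSpace.single (Fin.natAdd m k) 1) =
      Complex.I • toC m (EuclideanSpace.single (Fin.castAdd m k) 1) := by
  ext j
  simp only [toC_apply, Pi.smul_apply, smul_eq_mul]
  have h1 : ∀ a b : Fin m, Fin.castAdd m a ≠ Fin.natAdd m b := by
    intro a b h
    have := congrArg Fin.val h
    simp at this; omega
  have e1 : ∀ a b : Fin (m + m), (EuclideanSpace.single a (1:ℝ) : EuclideanSpace ℝ (Fin (m + m))) b =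
      if b = a then 1 else 0 := by intro a b; simp [Pi.single_apply]
  rw [e1, e1, e1, e1, if_neg (h1 _ _), if_neg (h1 _ _).symm]
  by_cases h : j = k
  · subst h; rw [if_pos rfl, if_pos rfl]; simp
  · have h2 : Fin.castAdd m j ≠ Fin.castAdd m k := by
      intro h'; exact h (Fin.castAdd_injective m m h')
    have h3 : Fin.natAdd m j ≠ Fin.natAdd m k := by
      intro h'; apply h; ext; have := congrArg Fin.val h'; simpa using this
    rw [if_neg h2, if_neg h3]; simp

lemma harmonic_of_holo (m : ℕ) (F : (Fin m → ℂ) → ℂ) (U : Set (Fin m → ℂ)) (hU : IsOpen U)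
    (hF : ContDiffOn ℂ 2 F U) (hmap : ∀ x ∈ unitBall (m + m), toC m x ∈ U) (A : ℂ →L[ℝ] ℝ) :
    IsHarmonicOn (fun x => A (F (toC m x))) (unitBall (m + m)) := by
  have hopen : IsOpen (unitBall (m + m)) := isOpen_ball
  constructor
  · have h1 : ContDiffOn ℝ 2 F U := hF.restrict_scalars ℝ
    exact A.contDiff.comp_contDiffOn (h1.comp (toC m).contDiff.contDiffOn hmap)
  · have hd1 : ∀ z ∈ U, DifferentiableAt ℂ F z := fun z hz =>
      (hF.contDiffAt (hU.mem_nhds hz)).differentiableAt (by simp)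
    have hd2 : ∀ z ∈ U, DifferentiableAt ℂ (fderiv ℂ F) z := by
      intro z hz
      have := (hF.contDiffAt (hU.mem_nhds hz)).fderiv_right (m := 1) (by norm_num)
      exact this.differentiableAt (by simp)
    have e1 : ∀ y ∈ unitBall (m + m), ∀ v, fderiv ℝ (fun x => A (F (toC m x))) y v =
        A (fderiv ℂ F (toC m y) (toC m v)) := by
      intro y hy v
      have h1 : HasFDerivAt F ((fderiv ℂ F (toC m y)).restrictScalars ℝ) (toC m y) :=
        (hd1 _ (hmap y hy)).hasFDerivAt.restrictScalars ℝ
      have h2 := A.hasFDerivAt.comp y (h1.comp y (toC m).hasFDerivAt)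
      have h3 : fderiv ℝ (fun x => A (F (toC m x))) y = _ := h2.fderiv
      rw [h3]; rfl
    have e2 : ∀ x ∈ unitBall (m + m), ∀ v,
        fderiv ℝ (fun y => fderiv ℝ (fun x => A (F (toC m x))) y v) x v =
        A (fderiv ℂ (fderiv ℂ F) (toC m x) (toC m v) (toC m v)) := by
      intro x hx v
      have hev : (fun y => fderiv ℝ (fun x => A (F (toC m x))) y v) =ᶠ[nhds x]
          (fun y => A (fderiv ℂ F (toC m y) (toC m v))) := by
        filter_upwards [hopen.mem_nhds hx] with y hy using e1 y hy v
      rw [hev.fderiv_eq]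
      have h0 : HasFDerivAt (fun z => fderiv ℂ F z (toC m v))
          ((ContinuousLinearMap.apply ℂ ℂ (toC m v)).comp (fderiv ℂ (fderiv ℂ F) (toC m x))) (toC m x) :=
        (ContinuousLinearMap.apply ℂ ℂ (toC m v)).hasFDerivAt.comp _ (hd2 _ (hmap x hx)).hasFDerivAt
      have h1 := h0.restrictScalars ℝ
      have h2 := A.hasFDerivAt.comp x (h1.comp x (toC m).hasFDerivAt)
      have h3 : fderiv ℝ (fun y => A (fderiv ℂ F (toC m y) (toC m v))) x = _ := h2.fderiv
      rw [h3]; rfl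
    intro x hx
    simp only [e2 x hx]
    rw [Fin.sum_univ_add, ← Finset.sum_add_distrib]
    apply Finset.sum_eq_zero
    intro k _
    rw [toC_single]
    simp only [map_smul, smul_apply, smul_smul, Complex.I_mul_I]
    simp

lemma legendre (φ : ℝ → ℝ) (hc : ConvexOn ℝ (Iio (0:ℝ)) φ) (hm : MonotoneOn φ (Iio (0:ℝ))) (L : ℝ)
    (hL : ∀ t < 0, L ≤ φ t) :
    ∃ (b : ℕ → ℝ) (C : ℝ), 0 ≤ C ∧ Monotone (tauB b) ∧ Monotone b ∧
      (∀ (n : ℕ) (t : ℝ), t < 0 → n * t + b n ≤ φ t) ∧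
      (∀ t < 0, ∃ n : ℕ, φ t - C ≤ n * t + b n) := by
  let b : ℕ → ℝ := fun n => ⨅ t : Iio (0:ℝ), (φ t - n * (t:ℝ))
  have : Nonempty (Iio (0:ℝ)) := ⟨⟨-1, by simp⟩⟩
  have hbd : ∀ n : ℕ, BddBelow (range (fun t : Iio (0:ℝ) => (φ t - n * (t:ℝ)))) := by
    intro n
    refine ⟨L, ?_⟩
    rintro _ ⟨t, rfl⟩
    have h1 := hL t t.2
    have h2 : (n:ℝ) * (t:ℝ) ≤ 0 := mul_nonpos_of_nonneg_of_nonpos (by positivity) (le_of_lt t.2)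
    simp only
    linarith
  have hle : ∀ (n : ℕ) (t : ℝ), t < 0 → b n ≤ φ t - n * t := by
    intro n t ht
    exact ciInf_le (hbd n) ⟨t, ht⟩
  have hge : ∀ (n : ℕ) (a : ℝ), (∀ t < 0, a ≤ φ t - n * t) → a ≤ b n := by
    intro n a h
    exact le_ciInf (fun t => h t t.2)
  have hmb : Monotone b := by
    apply monotone_nat_of_le_succ
    intro n
    apply hge
    intro t ht
    have := hle n t ht
    push_cast
    nlinarith
  refine ⟨b, 1 + |φ (-1) - L|, by positivity, ?_, hmb, ?_, ?_⟩
  · apply monotone_nat_of_le_succ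
    intro n
    unfold tauB
    have : (b n + b (n + 1 + 1)) / 2 ≤ b (n + 1) := by
      apply hge
      intro t ht
      have h1 := hle n t ht
      have h2 := hle (n + 1 + 1) t ht
      push_cast at h2 ⊢
      linarith
    linarith
  · intro n t ht
    have := hle n t ht
    linarith
  · intro t ht
    by_cases ht1 : t < -1
    · refine ⟨0, ?_⟩
      have h1 : L ≤ b 0 := hge 0 L (by intro t ht; simpa using hL t ht)
      have h2 := hm ht (show (-1:ℝ) ∈ Iio (0:ℝ) by simp) ht1.le
      have := le_abs_self (φ (-1) - L)
      push_cast
      linarith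
    · push Not at ht1
      -- right slope
      let S : Set ℝ := (fun s => (φ s - φ t) / (s - t)) '' Ioo t 0
      have hSb : ∀ s ∈ Ioo t 0, ∀ u < t, (φ t - φ u) / (t - u) ≤ (φ s - φ t) / (s - t) := by
        intro s hs u hu
        exact hc.slope_mono_adjacent (show u ∈ Iio (0:ℝ) from lt_trans hu ht) hs.2 hu hs.1
      have hS0 : ∀ s ∈ Ioo t 0, 0 ≤ (φ s - φ t) / (s - t) := by
        intro s hs
        have := hm ht hs.2 hs.1.le
        exact div_nonneg (by linarith) (by linarith [hs.1])
      have hSn : S.Nonempty := ⟨_, ⟨t / 2, ⟨by linarith, by linarith⟩, rfl⟩⟩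
      have hSbb : BddBelow S := ⟨0, by rintro _ ⟨s, hs, rfl⟩; exact hS0 s hs⟩
      set ρ := sInf S with hρ
      have hρ0 : 0 ≤ ρ := le_csInf hSn (by rintro _ ⟨s, hs, rfl⟩; exact hS0 s hs)
      have hr : ∀ s ∈ Ioo t 0, ρ * (s - t) ≤ φ s - φ t := by
        intro s hs
        have : ρ ≤ (φ s - φ t) / (s - t) := csInf_le hSbb ⟨s, hs, rfl⟩
        rwa [le_div_iff₀ (by linarith [hs.1])] at this
      have hl : ∀ u < t, φ t - φ u ≤ ρ * (t - u) := by
        intro u hu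
        have : (φ t - φ u) / (t - u) ≤ ρ :=
          le_csInf hSn (by rintro _ ⟨s, hs, rfl⟩; exact hSb s hs u hu)
        rwa [div_le_iff₀ (by linarith)] at this
      refine ⟨⌈ρ⌉₊, ?_⟩
      have hn1 := Nat.le_ceil ρ
      have hn2 := Nat.ceil_lt_add_one hρ0
      have : φ t - 1 - ⌈ρ⌉₊ * t ≤ b ⌈ρ⌉₊ := by
        apply hge
        intro s hs
        rcases lt_trichotomy s t with h | h | h
        · have := hl s h
          nlinarith
        · subst h; linarith
        · have := hr s ⟨h, hs⟩
          nlinarith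
      have := abs_nonneg (φ (-1) - L)
      linarith

lemma line_select (φ : ℝ → ℝ) (hc : ConvexOn ℝ (Iio (0:ℝ)) φ) (hm : MonotoneOn φ (Iio (0:ℝ))) (L : ℝ)
    (hL : ∀ t < 0, L ≤ φ t) (hunb : ∀ M : ℝ, ∃ t < 0, M < φ t) :
    ∃ (b : ℕ → ℝ) (s : ℕ → ℕ) (C : ℝ), ∀ t < 0, ∃ i1 : ℕ, φ t - C ≤ s i1 * t + b (s i1) ∧
      ∀ i : ℕ, s i * t + b (s i) ≤ φ t - |(i:ℝ) - i1| / 2 + 3 / 2 := by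
  classical
  obtain ⟨b, C, hC, hb, hmb, hle, hge⟩ := legendre φ hc hm L hL
  have hk : ∀ t < 0, ∃ k, t ≤ tauB b k := by
    intro t ht
    by_contra! hcon
    obtain ⟨n, hn⟩ := exists_nat_gt ((φ (t/2) - b 0) / (-t / 2))
    rw [div_lt_iff₀ (by linarith)] at hn
    have h1 := tau_le b (Nat.zero_le n) (t := t) (fun j _ => (hcon j).le)
    have h2 := hle n (t/2) (by linarith)
    push_cast at h1
    linarith
  have hact : ∀ t < 0, ∃ k, t ≤ tauB b k ∧ (∀ m < k, tauB b m ≤ t) ∧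
      (∀ n : ℕ, n * t + b n ≤ k * t + b k) := by
    intro t ht
    refine ⟨Nat.find (hk t ht), Nat.find_spec (hk t ht), fun m hmk => ?_, fun n => ?_⟩
    · have := Nat.find_min (hk t ht) hmk
      linarith
    · have h1 := Nat.find_spec (hk t ht)
      have h2 : ∀ m < Nat.find (hk t ht), tauB b m ≤ t := fun m hmk => by
        have := Nat.find_min (hk t ht) hmk
        linarith
      generalize Nat.find (hk t ht) = k at h1 h2
      rcases le_total k n with h | h
      · have := tau_ge b hb h h1
        linarith
      · have := tau_le b h h2
        linarith
  have hex : ∀ n, ∃ m, n < m ∧ 1 ≤ bA b n m ∧ 1 ≤ bB b n m := by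
    intro n
    obtain ⟨t, ht, hM⟩ := hunb (b n + C + 1)
    obtain ⟨N, hN⟩ := hge t ht
    obtain ⟨k, hk1, hk2, hk3⟩ := hact t ht
    have h1 := hk3 N
    have h2 : (k:ℝ) * t ≤ 0 := mul_nonpos_of_nonneg_of_nonpos (by positivity) ht.le
    have h2n : (n:ℝ) * t ≤ 0 := mul_nonpos_of_nonneg_of_nonpos (by positivity) ht.le
    have hnk : n < k := by
      by_contra! h
      have := hmb h
      linarith
    have hnk' : (n:ℝ) + 1 ≤ k := by exact_mod_cast hnk
    have hkt : ((k:ℝ) - n) * t ≤ ((k:ℝ) - n) * tauB b k := by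
      apply mul_le_mul_of_nonneg_left hk1; linarith
    have hB : 1 ≤ bB b n (k + 1) := by
      unfold bB
      simp only [Nat.add_sub_cancel]
      have : tauB b k = b k - b (k + 1) := rfl
      push_cast
      nlinarith
    have hgap : tauB b n < tauB b k := by
      have h3 := tau_ge b hb hnk.le (le_refl (tauB b n))
      by_contra! h
      have : ((k:ℝ) - n) * tauB b k ≤ ((k:ℝ) - n) * tauB b n :=
        mul_le_mul_of_nonneg_left h (by linarith)
      linarith
    obtain ⟨p, hp⟩ := exists_nat_gt (1 / (tauB b k - tauB b n))
    rw [div_lt_iff₀ (by linarith)] at hp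
    refine ⟨k + 1 + p, by omega, ?_, hB.trans (bB_mono b hb (by omega) (by omega))⟩
    have h4 := tau_ge b hb hnk.le (le_refl (tauB b n))
    have h5 := tau_ge b hb (show k ≤ k + 1 + p by omega) (le_refl (tauB b k))
    unfold bA
    push_cast at h5 ⊢
    nlinarith
  obtain ⟨s, hs0, hsm, h2, h3⟩ := greedy b hb hex
  refine ⟨b, s, C + 1, fun t ht => ?_⟩
  obtain ⟨k, hk1, hk2, hk3⟩ := hact t ht
  obtain ⟨i1, -, h4, h5⟩ := dominance b hb s hs0 hsm h2 h3 (fun _ => True) (fun _ _ _ _ => trivial) t k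
    trivial (fun m _ _ => hk1) hk2 (fun _ _ _ => trivial)
  obtain ⟨N, hN⟩ := hge t ht
  refine ⟨i1, by linarith [hk3 N], fun i => ?_⟩
  have := h5 i trivial
  linarith [hle k t ht]

lemma logconvex_lines (v : ℝ → ℝ) (hv : IsWeight v) (hlc : IsLogConvex v) :
    ∃ (b : ℕ → ℝ) (s : ℕ → ℕ) (C : ℝ), ∀ r ∈ Ioo (0:ℝ) 1, ∃ i1 : ℕ,
      Real.exp (-C) * v r ≤ Real.exp (b (s i1)) * r ^ (s i1) ∧
      ∀ i : ℕ, Real.exp (b (s i)) * r ^ (s i) ≤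
        Real.exp (3 / 2) * Real.exp (-|(i:ℝ) - i1| / 2) * v r := by
  obtain ⟨hcont, hmon, hpos, hunb⟩ := hv
  have hmem : ∀ t < 0, Real.exp t ∈ Ico (0:ℝ) 1 := fun t ht => ⟨(Real.exp_pos t).le, by simpa using ht⟩
  have h0 : (0:ℝ) ∈ Ico (0:ℝ) 1 := by simp
  obtain ⟨b, s, C, h⟩ := line_select (fun t => Real.log (v (Real.exp t))) hlc (by
      intro a ha c hc hac
      exact Real.log_le_log (hpos _ (hmem a ha)) (hmon (hmem a ha) (hmem c hc) (Real.exp_le_exp.2 hac)))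
    (Real.log (v 0)) (by
      intro t ht
      exact Real.log_le_log (hpos _ h0) (hmon h0 (hmem t ht) (Real.exp_pos t).le)) (by
      intro M
      obtain ⟨r, hr, hM⟩ := hunb (max (Real.exp M) (v 0))
      have hr0 : 0 < r := by
        rcases hr.1.lt_or_eq with h | h
        · exact h
        · subst h; exact absurd (lt_of_le_of_lt (le_max_right _ _) hM) (lt_irrefl _)
      refine ⟨Real.log r, Real.log_neg hr0 hr.2, ?_⟩
      rw [Real.exp_log hr0]
      exact (Real.lt_log_iff_exp_lt (hpos r hr)).2 (lt_of_le_of_lt (le_max_left _ _) hM))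
  refine ⟨b, s, C, fun r hr => ?_⟩
  obtain ⟨i1, h1, h2⟩ := h (Real.log r) (Real.log_neg hr.1 hr.2)
  have hvr : 0 < v r := hpos r ⟨hr.1.le, hr.2⟩
  simp only [Real.exp_log hr.1] at h1 h2
  have key : ∀ n : ℕ, Real.exp (b n) * r ^ n = Real.exp (n * Real.log r + b n) := by
    intro n
    rw [Real.exp_add, Real.exp_nat_mul, Real.exp_log hr.1, mul_comm]
  refine ⟨i1, ?_, fun i => ?_⟩
  · rw [key]
    nth_rewrite 1 [← Real.exp_log hvr]
    rw [← Real.exp_add]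
    exact Real.exp_le_exp.2 (by linarith)
  · rw [key]
    nth_rewrite 1 [← Real.exp_log hvr]
    rw [← Real.exp_add, ← Real.exp_add]
    exact Real.exp_le_exp.2 (by linarith [h2 i])

lemma holo_family (m : ℕ) (v : ℝ → ℝ) (hv : IsWeight v) (hlc : IsLogConvex v) :
    ∃ (q J : ℕ) (F : Fin q → Fin J → (Fin (m + 1) → ℂ) → ℂ) (c C : ℝ), 0 < c ∧ 0 < C ∧
      (∀ l j, ContDiffOn ℂ 2 (F l j) {z | cnrm z < 1}) ∧
      ∀ z, cnrm z < 1 → c * v (cnrm z) ≤ ∑ l, ∑ j, ‖F l j z‖ ∧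
        ∑ l, ∑ j, ‖F l j z‖ ≤ C * v (cnrm z) := by
  classical
  obtain ⟨b, s, C, h⟩ := logconvex_lines v hv hlc
  obtain ⟨hcont, hmon, hpos, hunb⟩ := hv
  obtain ⟨J, c0, C0, hc0, hC0, hpoly⟩ := poly_family m
  choose Q hQ1 hQ2 using hpoly
  obtain ⟨q, hq, c, C', hc, hC', hsieve⟩ := sieve (Real.exp (3/2)) (Real.exp (-C)) c0 C0
    (Real.exp_pos _) (Real.exp_pos _) hc0 hC0
  have hUo : IsOpen {z : Fin (m + 1) → ℂ | cnrm z < 1} := isOpen_lt continuous_cnrm continuous_const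
  have hn0 : ∀ z : Fin (m + 1) → ℂ, 0 ≤ cnrm z := fun z => Real.sqrt_nonneg _
  let G : ℕ → Fin J → (Fin (m + 1) → ℂ) → ℂ := fun i j z =>
    (Real.exp (b (s i)) : ℂ) * Q (s i) j z
  have hG : ∀ i z, c0 * (Real.exp (b (s i)) * cnrm z ^ (s i)) ≤ ∑ j, ‖G i j z‖ ∧
      ∑ j, ‖G i j z‖ ≤ C0 * (Real.exp (b (s i)) * cnrm z ^ (s i)) := by
    intro i z
    have e : ∑ j, ‖G i j z‖ = Real.exp (b (s i)) * ∑ j, ‖Q (s i) j z‖ := by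
      rw [Finset.mul_sum]
      apply Finset.sum_congr rfl
      intro j _
      simp only [G]
      rw [norm_mul, Complex.norm_real, Real.norm_of_nonneg (Real.exp_pos _).le]
    rw [e]
    obtain ⟨h1, h2⟩ := hQ2 (s i) z
    have := Real.exp_pos (b (s i))
    constructor
    · have := mul_le_mul_of_nonneg_left h1 this.le
      linarith
    · have := mul_le_mul_of_nonneg_left h2 this.le
      linarith
  let F : Fin q → Fin J → (Fin (m + 1) → ℂ) → ℂ := fun l j z =>
    ∑' i, (if i % q = l then G i j z else 0)
  have hF : ∀ l j, ContDiffOn ℂ 2 (F l j) {z | cnrm z < 1} := by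
    intro l j
    have := series_contDiffOn {z : Fin (m + 1) → ℂ | cnrm z < 1} hUo 2
      (fun i z => if i % q = l then G i j z else 0) (by
        intro i
        by_cases hi : i % q = l
        · simp only [hi, if_true]
          exact contDiff_const.mul (hQ1 _ _)
        · simp only [hi, if_false]
          exact contDiff_const) (by
        intro x hx
        obtain ⟨R, hR1, hR2⟩ := exists_between (show cnrm x < 1 from hx)
        have hR0 : 0 < R := lt_of_le_of_lt (hn0 x) hR1
        obtain ⟨δ, hδ, hδ2⟩ := Metric.isOpen_iff.1
          (isOpen_lt (continuous_cnrm (m := m + 1)) continuous_const) x hR1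
        obtain ⟨i1, -, hi1⟩ := h R ⟨hR0, hR2⟩
        obtain ⟨S, hS, hS2⟩ := exp_tail (1/2) (by norm_num)
        refine ⟨δ, hδ, fun i => C0 * (Real.exp (3/2) * Real.exp (-|(i:ℝ) - i1| / 2) * v R), ?_, ?_⟩
        · apply Summable.mul_left
          apply Summable.mul_right
          apply Summable.mul_left
          refine (hS2 i1).1.congr ?_
          intro i; congr 1; ring
        · intro i y hy
          have hy' : cnrm y < R := hδ2 hy
          have e1 : cnrm y ^ (s i) ≤ R ^ (s i) := pow_le_pow_left₀ (hn0 y) hy'.le _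
          have e2 : Real.exp (b (s i)) * cnrm y ^ (s i) ≤ Real.exp (b (s i)) * R ^ (s i) :=
            mul_le_mul_of_nonneg_left e1 (Real.exp_pos _).le
          have e3 : ‖G i j y‖ ≤ C0 * (Real.exp (3/2) * Real.exp (-|(i:ℝ) - i1| / 2) * v R) :=
            calc ‖G i j y‖ ≤ ∑ j, ‖G i j y‖ :=
                  Finset.single_le_sum (f := fun j => ‖G i j y‖) (fun _ _ => norm_nonneg _) (Finset.mem_univ j)
              _ ≤ _ := (hG i y).2
              _ ≤ _ := mul_le_mul_of_nonneg_left (e2.trans (hi1 i)) hC0.le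
          split_ifs
          · exact e3
          · rw [norm_zero]; exact (norm_nonneg _).trans e3)
    exact_mod_cast this
  have hmain : ∀ z, cnrm z < 1 → 0 < cnrm z → c * v (cnrm z) ≤ ∑ l, ∑ j, ‖F l j z‖ ∧
        ∑ l, ∑ j, ‖F l j z‖ ≤ C' * v (cnrm z) := by
    intro z hz hz0
    obtain ⟨i1, h1, h2⟩ := h _ ⟨hz0, hz⟩
    exact hsieve J (fun i j => G i j z) (fun i => Real.exp (b (s i)) * cnrm z ^ (s i)) (v (cnrm z)) i1
      (hpos _ ⟨hz0.le, hz⟩).le h1 h2 (fun i => hG i z)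
  refine ⟨q, J, F, c, C', hc, hC', hF, ?_⟩
  intro z hz
  by_cases hz0 : z = 0
  · subst hz0
    have hcv : ContinuousAt (fun z : Fin (m + 1) → ℂ => v (cnrm z)) 0 := by
      have : ContinuousOn (fun z : Fin (m + 1) → ℂ => v (cnrm z)) {z | cnrm z < 1} :=
        hcont.comp continuous_cnrm.continuousOn (fun z hz => ⟨hn0 z, hz⟩)
      exact this.continuousAt (hUo.mem_nhds hz)
    have hcF : ContinuousAt (fun z => ∑ l, ∑ j, ‖F l j z‖) 0 := by
      have : ContinuousOn (fun z => ∑ l, ∑ j, ‖F l j z‖) {z | cnrm z < 1} :=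
        continuousOn_finsetSum _ (fun l _ => continuousOn_finsetSum _ (fun j _ => (hF l j).continuousOn.norm))
      exact this.continuousAt (hUo.mem_nhds hz)
    have : (nhdsWithin (0 : Fin (m + 1) → ℂ) {0}ᶜ).NeBot := Module.punctured_nhds_neBot ℂ _ 0
    have hev : ∀ᶠ z in nhdsWithin (0 : Fin (m + 1) → ℂ) {0}ᶜ, cnrm z < 1 ∧ 0 < cnrm z := by
      have h1 : ∀ᶠ z in nhdsWithin (0 : Fin (m + 1) → ℂ) {0}ᶜ, cnrm z < 1 :=
        mem_nhdsWithin_of_mem_nhds (hUo.mem_nhds hz)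
      filter_upwards [h1, self_mem_nhdsWithin] with z hz1 hz2
      refine ⟨hz1, ?_⟩
      apply Real.sqrt_pos.2
      obtain ⟨k, hk⟩ : ∃ k, z k ≠ 0 := by
        by_contra! hcon
        exact hz2 (funext hcon)
      exact Finset.sum_pos' (fun _ _ => by positivity) ⟨k, Finset.mem_univ _, by positivity⟩
    constructor
    · exact le_of_tendsto_of_tendsto (hcv.continuousWithinAt.tendsto.const_mul c)
        hcF.continuousWithinAt.tendsto (hev.mono (fun z hz => (hmain z hz.1 hz.2).1))
    · exact le_of_tendsto_of_tendsto hcF.continuousWithinAt.tendsto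
        (hcv.continuousWithinAt.tendsto.const_mul C') (hev.mono (fun z hz => (hmain z hz.1 hz.2).2))
  · refine hmain z hz ?_
    apply Real.sqrt_pos.2
    obtain ⟨k, hk⟩ : ∃ k, z k ≠ 0 := by
      by_contra! hcon
      exact hz0 (funext hcon)
    exact Finset.sum_pos' (fun _ _ => by positivity) ⟨k, Finset.mem_univ _, by positivity⟩

lemma if_dir (m : ℕ) (v : ℝ → ℝ) (hv : IsWeight v) (hlc : IsLogConvex v) :
    ∃ (J : ℕ) (f : Fin J → (EuclideanSpace ℝ (Fin ((m + 1) + (m + 1))) → ℝ)),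
      (∀ j, IsHarmonicOn (f j) (unitBall ((m + 1) + (m + 1)))) ∧
      ∃ C₁ C₂ : ℝ, 0 < C₁ ∧ 0 < C₂ ∧ ∀ x ∈ unitBall ((m + 1) + (m + 1)),
        C₁ * v ‖x‖ ≤ ∑ j, |f j x| ∧ ∑ j, |f j x| ≤ C₂ * v ‖x‖ := by
  obtain ⟨q, J, F, c, C, hc, hC, hF, hFb⟩ := holo_family m v hv hlc
  have hUo : IsOpen {z : Fin (m + 1) → ℂ | cnrm z < 1} := isOpen_lt continuous_cnrm continuous_const
  let A : Fin 2 → (ℂ →L[ℝ] ℝ) := fun a => if a = 0 then Complex.reCLM else Complex.imCLM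
  let g : Fin q × Fin J × Fin 2 → (EuclideanSpace ℝ (Fin ((m + 1) + (m + 1))) → ℝ) :=
    fun p x => A p.2.2 (F p.1 p.2.1 (toC (m + 1) x))
  let e := Fintype.equivFin (Fin q × Fin J × Fin 2)
  have hmap : ∀ x ∈ unitBall ((m + 1) + (m + 1)), cnrm (toC (m + 1) x) < 1 := by
    intro x hx
    rw [cnrm_toC]
    simpa [unitBall] using hx
  refine ⟨_, fun j => g (e.symm j), fun j => ?_, c, 2 * C, hc, by positivity, fun x hx => ?_⟩
  · exact harmonic_of_holo (m + 1) (F _ _) {z | cnrm z < 1} hUo (hF _ _) hmap _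
  · have hs : ∑ j, |g (e.symm j) x| = ∑ l, ∑ j, (|(F l j (toC (m + 1) x)).re| + |(F l j (toC (m + 1) x)).im|) := by
      rw [Equiv.sum_comp e.symm (fun p => |g p x|), Fintype.sum_prod_type]
      apply Finset.sum_congr rfl; intro l _
      rw [Fintype.sum_prod_type]
      apply Finset.sum_congr rfl; intro j _
      rw [Fin.sum_univ_two]
      simp [g, A]
    rw [hs]
    obtain ⟨h1, h2⟩ := hFb _ (hmap x hx)
    rw [cnrm_toC] at h1 h2
    constructor
    · refine h1.trans ?_
      gcongr with l _ j _
      exact Complex.norm_le_abs_re_add_abs_im _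
    · have : ∑ l, ∑ j, (|(F l j (toC (m + 1) x)).re| + |(F l j (toC (m + 1) x)).im|) ≤
          ∑ l, ∑ j, 2 * ‖F l j (toC (m + 1) x)‖ := by
        gcongr with l _ j _
        linarith [Complex.abs_re_le_norm (F l j (toC (m + 1) x)), Complex.abs_im_le_norm (F l j (toC (m + 1) x))]
      refine this.trans ?_
      simp only [← Finset.mul_sum]
      linarith

lemma integrable_of_contOn_ball {d : ℕ} (p : EuclideanSpace ℝ (Fin d) → ℝ)
    (hp : ContinuousOn p (closedBall 0 1)) (h0 : ∀ x ∉ closedBall (0 : EuclideanSpace ℝ (Fin d)) 1, p x = 0) :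
    Integrable p := by
  have h1 : IntegrableOn p (closedBall 0 1) := hp.integrableOn_compact (isCompact_closedBall _ _)
  refine (integrableOn_iff_integrable_of_support_subset ?_).1 h1
  intro x hx
  by_contra hcon
  exact hx (h0 x hcon)

lemma sum_single {d : ℕ} (L : EuclideanSpace ℝ (Fin d) →L[ℝ] ℝ) (x : EuclideanSpace ℝ (Fin d)) :
    ∑ i, x i * L (EuclideanSpace.single i 1) = L x := by
  have : x = ∑ i, x i • EuclideanSpace.single i (1:ℝ) := by
    ext j
    simp [Pi.single_apply]
  conv_rhs => rw [this]
  rw [map_sum]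
  simp

lemma green {d : ℕ} (η : ℝ → ℝ) (hη : ContDiff ℝ 1 η) (h1 : ∀ u, 1 ≤ u → η u = 0)
    (U : Set (EuclideanSpace ℝ (Fin d))) (hU : IsOpen U) (hBU : closedBall 0 1 ⊆ U)
    (F G : EuclideanSpace ℝ (Fin d) → ℝ) (hF : IsHarmonicOn F U) (hG : IsHarmonicOn G U) :
    ∫ x in closedBall (0 : EuclideanSpace ℝ (Fin d)) 1,
      (fderiv ℝ F x x * G x - F x * fderiv ℝ G x x) * deriv η (‖x‖ ^ 2) = 0 := by
  have hηd : ∀ u, HasDerivAt η (deriv η u) u := fun u =>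
    (hη.differentiable (by simp) u).hasDerivAt
  have hηc : Continuous (deriv η) := hη.continuous_deriv (by simp)
  have hd0 : ∀ u, 1 < u → deriv η u = 0 := by
    intro u hu
    have : η =ᶠ[nhds u] fun _ => 0 := by
      filter_upwards [Ioi_mem_nhds hu] with y hy using h1 y (le_of_lt hy)
    rw [this.deriv_eq]; simp
  let χ : EuclideanSpace ℝ (Fin d) → ℝ := fun x => η (‖x‖ ^ 2)
  have hχ : ∀ x, HasFDerivAt χ (deriv η (‖x‖ ^ 2) • (2 • (innerSL ℝ x))) x := by
    intro x
    exact (hηd _).comp_hasFDerivAt x (hasStrictFDerivAt_norm_sq x).hasFDerivAt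
  have hout : ∀ x ∉ closedBall (0 : EuclideanSpace ℝ (Fin d)) 1, 1 < ‖x‖ ^ 2 := by
    intro x hx
    rw [mem_closedBall_zero_iff, not_le] at hx
    nlinarith
  have hχ0 : ∀ x ∉ closedBall (0 : EuclideanSpace ℝ (Fin d)) 1, χ x = 0 := fun x hx =>
    h1 _ (hout x hx).le
  have hts : tsupport χ ⊆ closedBall 0 1 := by
    apply closure_minimal _ isClosed_closedBall
    intro x hx
    by_contra hcon
    exact hx (hχ0 x hcon)
  have hχc : Continuous χ := hη.continuous.comp (continuous_norm.pow 2)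
  let e : Fin d → EuclideanSpace ℝ (Fin d) := fun i => EuclideanSpace.single i 1
  let W : Fin d → EuclideanSpace ℝ (Fin d) → ℝ := fun i x =>
    fderiv ℝ F x (e i) * G x - F x * fderiv ℝ G x (e i)
  have hF1 : ∀ i, ContDiffOn ℝ 1 (fun x => fderiv ℝ F x (e i)) U := fun i =>
    (hF.1.fderiv_of_isOpen hU (by norm_num)).clm_apply contDiffOn_const
  have hG1 : ∀ i, ContDiffOn ℝ 1 (fun x => fderiv ℝ G x (e i)) U := fun i =>
    (hG.1.fderiv_of_isOpen hU (by norm_num)).clm_apply contDiffOn_const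
  have hW : ∀ i, ContDiffOn ℝ 1 (W i) U := fun i =>
    ((hF1 i).mul (hG.1.of_le (by norm_num))).sub ((hF.1.of_le (by norm_num)).mul (hG1 i))
  have hWd : ∀ i, ∀ x ∈ U, DifferentiableAt ℝ (W i) x := fun i x hx =>
    ((hW i).contDiffAt (hU.mem_nhds hx)).differentiableAt (by simp)
  have hWc' : ∀ i, ContinuousOn (fun x => fderiv ℝ (W i) x (e i)) U := fun i =>
    ((hW i).continuousOn_fderiv_of_isOpen hU (by simp)).clm_apply continuousOn_const
  have hχ' : ∀ x i, fderiv ℝ χ x (e i) = deriv η (‖x‖ ^ 2) * (2 * x i) := by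
    intro x i
    rw [(hχ x).fderiv]
    simp [e, EuclideanSpace.inner_single_right]
  have hχ'c : ∀ i, Continuous (fun x => fderiv ℝ χ x (e i)) := by
    intro i
    simp only [hχ']
    fun_prop
  have hib : ∀ i, ∫ x, W i x * fderiv ℝ χ x (e i) = - ∫ x, fderiv ℝ (W i) x (e i) * χ x := by
    intro i
    apply integral_mul_fderiv_eq_neg_fderiv_mul_of_integrable
    · apply integrable_of_contOn_ball
      · exact ((hWc' i).mono hBU).mul hχc.continuousOn
      · intro x hx; rw [hχ0 x hx, mul_zero]
    · apply integrable_of_contOn_ball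
      · exact ((hW i).continuousOn.mono hBU).mul (hχ'c i).continuousOn
      · intro x hx; rw [hχ', hd0 _ (hout x hx)]; simp
    · apply integrable_of_contOn_ball
      · exact ((hW i).continuousOn.mono hBU).mul hχc.continuousOn
      · intro x hx; rw [hχ0 x hx, mul_zero]
    · intro x hx
      exact hWd i x (hBU (hts hx))
    · intro x _
      exact (hχ x).differentiableAt
  have hint1 : ∀ i, Integrable (fun x => W i x * fderiv ℝ χ x (e i)) := by
    intro i
    apply integrable_of_contOn_ball
    · exact ((hW i).continuousOn.mono hBU).mul (hχ'c i).continuousOn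
    · intro x hx; rw [hχ', hd0 _ (hout x hx)]; simp
  have hint2 : ∀ i, Integrable (fun x => fderiv ℝ (W i) x (e i) * χ x) := by
    intro i
    apply integrable_of_contOn_ball
    · exact ((hWc' i).mono hBU).mul hχc.continuousOn
    · intro x hx; rw [hχ0 x hx, mul_zero]
  have hlap : ∀ x ∈ U, ∑ i, fderiv ℝ (W i) x (e i) = 0 := by
    intro x hx
    have hFx : HasFDerivAt F (fderiv ℝ F x) x :=
      ((hF.1.contDiffAt (hU.mem_nhds hx)).differentiableAt (by simp)).hasFDerivAt
    have hGx : HasFDerivAt G (fderiv ℝ G x) x :=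
      ((hG.1.contDiffAt (hU.mem_nhds hx)).differentiableAt (by simp)).hasFDerivAt
    have hWi : ∀ i, fderiv ℝ (W i) x (e i) =
        G x * fderiv ℝ (fun y => fderiv ℝ F y (e i)) x (e i) -
        F x * fderiv ℝ (fun y => fderiv ℝ G y (e i)) x (e i) := by
      intro i
      have hFi : HasFDerivAt (fun y => fderiv ℝ F y (e i)) (fderiv ℝ (fun y => fderiv ℝ F y (e i)) x) x :=
        (((hF1 i).contDiffAt (hU.mem_nhds hx)).differentiableAt (by simp)).hasFDerivAt
      have hGi : HasFDerivAt (fun y => fderiv ℝ G y (e i)) (fderiv ℝ (fun y => fderiv ℝ G y (e i)) x) x :=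
        (((hG1 i).contDiffAt (hU.mem_nhds hx)).differentiableAt (by simp)).hasFDerivAt
      have h := (hFi.mul hGx).sub (hFx.mul hGi)
      have h' : HasFDerivAt (W i) _ x := h
      rw [h'.fderiv]
      simp
      ring
    simp only [hWi, Finset.sum_sub_distrib, ← Finset.mul_sum]
    rw [hF.2 x hx, hG.2 x hx]
    simp
  have hsum : ∫ x, ∑ i, W i x * fderiv ℝ χ x (e i) = 0 := by
    rw [integral_finsetSum _ (fun i _ => hint1 i)]
    simp only [hib]
    rw [Finset.sum_neg_distrib, ← integral_finsetSum _ (fun i _ => hint2 i)]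
    rw [neg_eq_zero]
    apply integral_eq_zero_of_ae
    refine Filter.Eventually.of_forall (fun x => ?_)
    simp only [Pi.zero_apply]
    rw [← Finset.sum_mul]
    by_cases hx : x ∈ closedBall (0 : EuclideanSpace ℝ (Fin d)) 1
    · rw [hlap x (hBU hx), zero_mul]
    · rw [hχ0 x hx, mul_zero]
  have hpt : ∀ x, ∑ i, W i x * fderiv ℝ χ x (e i) =
      2 * ((fderiv ℝ F x x * G x - F x * fderiv ℝ G x x) * deriv η (‖x‖ ^ 2)) := by
    intro x
    rw [← sum_single (fderiv ℝ F x) x, ← sum_single (fderiv ℝ G x) x]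
    simp only [hχ', W, Finset.sum_mul, Finset.mul_sum, ← Finset.sum_sub_distrib]
    apply Finset.sum_congr rfl
    intro i _
    ring
  simp only [hpt] at hsum
  rw [integral_const_mul] at hsum
  rw [setIntegral_eq_integral_of_forall_compl_eq_zero]
  · linarith
  · intro x hx
    rw [hd0 _ (hout x hx), mul_zero]

lemma harmonic_scale {d : ℕ} (f : EuclideanSpace ℝ (Fin d) → ℝ) (hf : IsHarmonicOn f (unitBall d))
    (c : ℝ) : IsHarmonicOn (fun x => f (c • x)) {x | c • x ∈ unitBall d} := by
  constructor
  · exact hf.1.comp (contDiff_const_smul c).contDiffOn (fun x hx => hx)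
  · intro x hx
    have h1 : ∀ i, fderiv ℝ (fun y => fderiv ℝ (fun x => f (c • x)) y (EuclideanSpace.single i 1)) x
        (EuclideanSpace.single i 1) = c * (c * fderiv ℝ (fun y => fderiv ℝ f y (EuclideanSpace.single i 1)) (c • x)
        (EuclideanSpace.single i 1)) := by
      intro i
      have h2 : (fun y => fderiv ℝ (fun x => f (c • x)) y (EuclideanSpace.single i 1)) =
          fun y => c • (fun z => fderiv ℝ f z (EuclideanSpace.single i 1)) (c • y) := by
        funext y
        rw [fderiv_comp_smul]; rfl
      rw [h2]
      have h3 : HasFDerivAt (fun z => fderiv ℝ f z (EuclideanSpace.single i 1))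
          (fderiv ℝ (fun z => fderiv ℝ f z (EuclideanSpace.single i 1)) (c • x)) (c • x) := by
        have h4 : ContDiffOn ℝ 1 (fun z => fderiv ℝ f z (EuclideanSpace.single i 1)) (unitBall d) :=
          (hf.1.fderiv_of_isOpen isOpen_ball (by norm_num)).clm_apply contDiffOn_const
        exact ((h4.contDiffAt (isOpen_ball.mem_nhds hx)).differentiableAt (by simp)).hasFDerivAt
      have h5 := (h3.comp x ((hasFDerivAt_id x).const_smul c)).const_smul c
      have h6 : HasFDerivAt (fun y => c • (fun z => fderiv ℝ f z (EuclideanSpace.single i 1)) (c • y)) _ x := h5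
      rw [h6.fderiv]
      simp
    simp only [h1, ← Finset.mul_sum]
    rw [hf.2 _ hx]
    simp

lemma energy_id {d : ℕ} (η : ℝ → ℝ) (hη : ContDiff ℝ 1 η) (h1 : ∀ u, 1 ≤ u → η u = 0)
    (f : EuclideanSpace ℝ (Fin d) → ℝ) (hf : IsHarmonicOn f (unitBall d)) (p q : ℝ) (hp : p < 0) (hq : q < 0) :
    ∫ x in closedBall (0 : EuclideanSpace ℝ (Fin d)) 1,
      f (Real.exp p • x) * f (Real.exp q • x) * deriv η (‖x‖ ^ 2) =
    ∫ x in closedBall (0 : EuclideanSpace ℝ (Fin d)) 1,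
      f (Real.exp ((p + q) / 2) • x) * f (Real.exp ((p + q) / 2) • x) * deriv η (‖x‖ ^ 2) := by
  set B := closedBall (0 : EuclideanSpace ℝ (Fin d)) 1 with hB
  have hBc : IsCompact B := isCompact_closedBall _ _
  have hηc : Continuous (deriv η) := hη.continuous_deriv (by simp)
  have hkc : Continuous (fun x : EuclideanSpace ℝ (Fin d) => deriv η (‖x‖ ^ 2)) := by fun_prop
  set a := (p + q) / 2 with ha
  have ha0 : a < 0 := by linarith
  have hin : ∀ t < 0, ∀ x ∈ B, Real.exp t • x ∈ unitBall d := by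
    intro t ht x hx
    rw [hB, mem_closedBall_zero_iff] at hx
    rw [unitBall, mem_ball_zero_iff, norm_smul, Real.norm_of_nonneg (Real.exp_pos t).le]
    have : Real.exp t < 1 := by simpa using ht
    nlinarith [Real.exp_pos t, norm_nonneg x]
  have hfc : ContinuousOn f (unitBall d) := hf.1.continuousOn
  have hf'c : ContinuousOn (fderiv ℝ f) (unitBall d) :=
    hf.1.continuousOn_fderiv_of_isOpen isOpen_ball (by norm_num)
  have hfd : ∀ y ∈ unitBall d, HasFDerivAt f (fderiv ℝ f y) y := fun y hy =>
    ((hf.1.contDiffAt (isOpen_ball.mem_nhds hy)).differentiableAt (by simp)).hasFDerivAt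
  let Φ : ℝ → EuclideanSpace ℝ (Fin d) → ℝ := fun u x =>
    f (Real.exp (a + u) • x) * f (Real.exp (a - u) • x) * deriv η (‖x‖ ^ 2)
  let Φ' : ℝ → EuclideanSpace ℝ (Fin d) → ℝ := fun u x =>
    (fderiv ℝ f (Real.exp (a + u) • x) (Real.exp (a + u) • x) * f (Real.exp (a - u) • x) -
      f (Real.exp (a + u) • x) * fderiv ℝ f (Real.exp (a - u) • x) (Real.exp (a - u) • x)) * deriv η (‖x‖ ^ 2)
  let I : Set ℝ := Ioo a (-a)
  have hc1 : ContinuousOn (fun z : ℝ × EuclideanSpace ℝ (Fin d) => Φ z.1 z.2) (I ×ˢ B) := by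
    have e1 : ContinuousOn (fun z : ℝ × EuclideanSpace ℝ (Fin d) => f (Real.exp (a + z.1) • z.2)) (I ×ˢ B) :=
      hfc.comp (by fun_prop) (fun z hz => hin _ (by linarith [hz.1.2]) _ hz.2)
    have e2 : ContinuousOn (fun z : ℝ × EuclideanSpace ℝ (Fin d) => f (Real.exp (a - z.1) • z.2)) (I ×ˢ B) :=
      hfc.comp (by fun_prop) (fun z hz => hin _ (by linarith [hz.1.1]) _ hz.2)
    exact (e1.mul e2).mul (hkc.comp continuous_snd).continuousOn
  have hc2 : ContinuousOn (fun z : ℝ × EuclideanSpace ℝ (Fin d) => Φ' z.1 z.2) (I ×ˢ B) := by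
    have e1 : ContinuousOn (fun z : ℝ × EuclideanSpace ℝ (Fin d) => f (Real.exp (a + z.1) • z.2)) (I ×ˢ B) :=
      hfc.comp (by fun_prop) (fun z hz => hin _ (by linarith [hz.1.2]) _ hz.2)
    have e2 : ContinuousOn (fun z : ℝ × EuclideanSpace ℝ (Fin d) => f (Real.exp (a - z.1) • z.2)) (I ×ˢ B) :=
      hfc.comp (by fun_prop) (fun z hz => hin _ (by linarith [hz.1.1]) _ hz.2)
    have e3 : ContinuousOn (fun z : ℝ × EuclideanSpace ℝ (Fin d) =>
        fderiv ℝ f (Real.exp (a + z.1) • z.2)) (I ×ˢ B) :=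
      hf'c.comp (by fun_prop) (fun z hz => hin _ (by linarith [hz.1.2]) _ hz.2)
    have e4 : ContinuousOn (fun z : ℝ × EuclideanSpace ℝ (Fin d) =>
        fderiv ℝ f (Real.exp (a - z.1) • z.2)) (I ×ˢ B) :=
      hf'c.comp (by fun_prop) (fun z hz => hin _ (by linarith [hz.1.1]) _ hz.2)
    exact (((e3.clm_apply (by fun_prop)).mul e2).sub (e1.mul (e4.clm_apply (by fun_prop)))).mul
      (hkc.comp continuous_snd).continuousOn
  have hs1 : ∀ u ∈ I, ContinuousOn (Φ u) B := fun u hu =>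
    hc1.comp (f := fun x => (u, x)) (by fun_prop) (fun x hx => ⟨hu, hx⟩)
  have hs2 : ∀ u ∈ I, ContinuousOn (Φ' u) B := fun u hu =>
    hc2.comp (f := fun x => (u, x)) (by fun_prop) (fun x hx => ⟨hu, hx⟩)
  have hder : ∀ u ∈ I, HasDerivAt (fun u => ∫ x in B, Φ u x) (∫ x in B, Φ' u x) u := by
    intro u hu
    obtain ⟨ε, hε, hεI⟩ := Metric.nhds_basis_closedBall.mem_iff.1 (isOpen_Ioo.mem_nhds hu)
    obtain ⟨M, hM⟩ := ((isCompact_closedBall u ε).prod hBc).exists_bound_of_continuousOn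
      (hc2.mono (prod_mono hεI subset_rfl))
    have hfin : IsFiniteMeasure ((volume : Measure (EuclideanSpace ℝ (Fin d))).restrict B) :=
      ⟨by rw [Measure.restrict_apply_univ]; exact hBc.measure_lt_top⟩
    refine (hasDerivAt_integral_of_dominated_loc_of_deriv_le (F' := Φ') (bound := fun _ => M)
      (closedBall_mem_nhds u hε) ?_ ?_ ?_ ?_ ?_ ?_).2
    · filter_upwards [isOpen_Ioo.mem_nhds hu] with y hy
      exact (hs1 y hy).aestronglyMeasurable hBc.measurableSet
    · exact (hs1 u hu).integrableOn_compact hBc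
    · exact (hs2 u hu).aestronglyMeasurable hBc.measurableSet
    · filter_upwards [ae_restrict_mem hBc.measurableSet] with x hx y hy
      exact hM (y, x) ⟨hy, hx⟩
    · exact integrable_const M
    · filter_upwards [ae_restrict_mem hBc.measurableSet] with x hx y hy
      have hyI := hεI hy
      have d1 : HasDerivAt (fun u => Real.exp (a + u) • x) (Real.exp (a + y) • x) y := by
        have := ((hasDerivAt_id y).const_add a).exp.smul_const x
        simpa using this
      have d2 : HasDerivAt (fun u => Real.exp (a - u) • x) (-(Real.exp (a - y) • x)) y := by
        have := ((hasDerivAt_id y).const_sub a).exp.smul_const x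
        simpa using this
      have d3 := (hfd _ (hin (a + y) (by linarith [hyI.2]) x hx)).comp_hasDerivAt y d1
      have d4 := (hfd _ (hin (a - y) (by linarith [hyI.1]) x hx)).comp_hasDerivAt y d2
      have d5 := (d3.mul d4).mul_const (deriv η (‖x‖ ^ 2))
      refine d5.congr_deriv ?_
      simp only [Φ', Function.comp_apply, map_neg]
      ring
  have hzero : ∀ u ∈ I, ∫ x in B, Φ' u x = 0 := by
    intro u hu
    have g := green η hη h1
      ({x | Real.exp (a + u) • x ∈ unitBall d} ∩ {x | Real.exp (a - u) • x ∈ unitBall d})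
      ((isOpen_ball.preimage (continuous_const_smul _)).inter (isOpen_ball.preimage (continuous_const_smul _)))
      (fun x hx => ⟨hin _ (by linarith [hu.2]) x hx, hin _ (by linarith [hu.1]) x hx⟩)
      (fun x => f (Real.exp (a + u) • x)) (fun x => f (Real.exp (a - u) • x))
      ⟨(harmonic_scale f hf _).1.mono inter_subset_left, fun x hx => (harmonic_scale f hf _).2 x hx.1⟩
      ⟨(harmonic_scale f hf _).1.mono inter_subset_right, fun x hx => (harmonic_scale f hf _).2 x hx.2⟩
    rw [← g]
    congr 1
    funext x
    simp only [Φ', fderiv_comp_smul, smul_apply, map_smul]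
  have h0I : (0:ℝ) ∈ I := ⟨ha0, by linarith⟩
  have huI : (p - q) / 2 ∈ I := ⟨by rw [ha]; linarith, by rw [ha]; linarith⟩
  have hconst := isOpen_Ioo.is_const_of_deriv_eq_zero (isPreconnected_Ioo)
    (f := fun u => ∫ x in B, Φ u x) (s := I)
    (fun u hu => (hder u hu).differentiableAt.differentiableWithinAt)
    (fun u hu => by rw [(hder u hu).deriv, hzero u hu]; rfl) huI h0I
  have e1 : a + (p - q) / 2 = p := by rw [ha]; ring
  have e2 : a - (p - q) / 2 = q := by rw [ha]; ring
  simp only [Φ, e1, e2, add_zero, sub_zero] at hconst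
  exact hconst

set_option maxHeartbeats 400000 in
lemma kernel_exists (d : ℕ) (hd : 2 ≤ d) (δ : ℝ) (hδ : δ ∈ Ioo (0:ℝ) 1) :
    ∃ ψ : EuclideanSpace ℝ (Fin d) → ℝ, Continuous ψ ∧ (∀ x, 0 ≤ ψ x) ∧
      (∀ x, ψ x ≠ 0 → 1 - δ ≤ ‖x‖ ^ 2) ∧
      (∫ x in closedBall (0 : EuclideanSpace ℝ (Fin d)) 1, ψ x = 1) ∧
      ∀ f : EuclideanSpace ℝ (Fin d) → ℝ, IsHarmonicOn f (unitBall d) → ∀ p q : ℝ, p < 0 → q < 0 →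
        ∫ x in closedBall (0 : EuclideanSpace ℝ (Fin d)) 1, f (Real.exp p • x) * f (Real.exp q • x) * ψ x =
        ∫ x in closedBall (0 : EuclideanSpace ℝ (Fin d)) 1,
          f (Real.exp ((p + q) / 2) • x) * f (Real.exp ((p + q) / 2) • x) * ψ x := by
  obtain ⟨hδ0, hδ1⟩ := hδ
  let η : ℝ → ℝ := fun u => Real.smoothTransition ((1 - u) / δ)
  have hη : ContDiff ℝ 1 η := by
    have : ContDiff ℝ 1 Real.smoothTransition := by
      exact_mod_cast Real.smoothTransition.contDiff (n := 1)
    exact this.comp (by fun_prop)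
  have h1 : ∀ u, 1 ≤ u → η u = 0 := fun u hu =>
    Real.smoothTransition.zero_of_nonpos (div_nonpos_of_nonpos_of_nonneg (by linarith) hδ0.le)
  have h2 : ∀ u, u ≤ 1 - δ → η u = 1 := fun u hu =>
    Real.smoothTransition.one_of_one_le (by rw [le_div_iff₀ hδ0]; linarith)
  have hanti : Antitone η := by
    intro x y hxy
    apply Real.smoothTransition.monotone
    gcongr
  have hηc : Continuous (deriv η) := hη.continuous_deriv (by simp)
  have hneg : ∀ u, deriv η u ≤ 0 := fun u => hanti.deriv_nonpos
  have hd0 : ∀ u, 1 < u → deriv η u = 0 := by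
    intro u hu
    have : η =ᶠ[nhds u] fun _ => 0 := by
      filter_upwards [Ioi_mem_nhds hu] with y hy using h1 y (le_of_lt hy)
    rw [this.deriv_eq]; simp
  have hd1 : ∀ u, u < 1 - δ → deriv η u = 0 := by
    intro u hu
    have : η =ᶠ[nhds u] fun _ => 1 := by
      filter_upwards [Iio_mem_nhds hu] with y hy using h2 y (le_of_lt hy)
    rw [this.deriv_eq]; simp
  obtain ⟨u0, hu0, hu1⟩ := exists_deriv_eq_slope η (show 1 - δ < 1 by linarith)
    hη.continuous.continuousOn (hη.differentiable (by simp)).differentiableOn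
  have hu2 : deriv η u0 ≠ 0 := by
    rw [hu1, h1 1 le_rfl, h2 _ le_rfl]
    simp only [sub_sub_cancel]
    exact div_ne_zero (by norm_num) hδ0.ne'
  let k : EuclideanSpace ℝ (Fin d) → ℝ := fun x => - deriv η (‖x‖ ^ 2)
  have hkc : Continuous k := by
    have : Continuous (fun x : EuclideanSpace ℝ (Fin d) => deriv η (‖x‖ ^ 2)) := by fun_prop
    exact this.neg
  have hk0 : ∀ x ∉ closedBall (0 : EuclideanSpace ℝ (Fin d)) 1, k x = 0 := by
    intro x hx
    rw [mem_closedBall_zero_iff, not_le] at hx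
    simp only [k]
    rw [hd0 _ (by nlinarith), neg_zero]
  have hpos : 0 < ∫ x, k x := by
    refine hkc.integral_pos_of_hasCompactSupport_nonneg_nonzero
      (x := EuclideanSpace.single (⟨0, by omega⟩ : Fin d) (Real.sqrt u0)) ?_ ?_ ?_
    · apply HasCompactSupport.intro (isCompact_closedBall (0 : EuclideanSpace ℝ (Fin d)) 1)
      exact hk0
    · intro x
      have := hneg (‖x‖ ^ 2)
      simp only [k, Pi.zero_apply]
      linarith
    · simp only [k]
      rw [PiLp.norm_single, Real.norm_of_nonneg (Real.sqrt_nonneg _), Real.sq_sqrt (by linarith [hu0.1])]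
      exact neg_ne_zero.2 hu2
  have hB : ∫ x in closedBall (0 : EuclideanSpace ℝ (Fin d)) 1, k x = ∫ x, k x :=
    setIntegral_eq_integral_of_forall_compl_eq_zero (fun x hx => hk0 x hx)
  set N := ∫ x, k x with hN
  refine ⟨fun x => N⁻¹ * k x, by fun_prop, ?_, ?_, ?_, ?_⟩
  · intro x
    have : 0 ≤ k x := by
      have := hneg (‖x‖ ^ 2)
      simp only [k]; linarith
    exact mul_nonneg (inv_nonneg.2 hpos.le) this
  · intro x hx
    by_contra! hcon
    apply hx
    simp only [k]
    rw [hd1 _ hcon]; simp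
  · rw [integral_const_mul, hB]
    exact inv_mul_cancel₀ hpos.ne'
  · intro f hf p q hp hq
    have h := energy_id η hη h1 f hf p q hp hq
    have e : ∀ (g : EuclideanSpace ℝ (Fin d) → ℝ),
        ∫ x in closedBall (0 : EuclideanSpace ℝ (Fin d)) 1, g x * (N⁻¹ * k x) =
        (-N⁻¹) * ∫ x in closedBall (0 : EuclideanSpace ℝ (Fin d)) 1, g x * deriv η (‖x‖ ^ 2) := by
      intro g
      rw [← integral_const_mul]
      congr 1
      funext x
      simp only [k]
      ring
    rw [e (fun x => f (Real.exp p • x) * f (Real.exp q • x)),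
      e (fun x => f (Real.exp ((p + q) / 2) • x) * f (Real.exp ((p + q) / 2) • x)), h]

lemma energy_family (d : ℕ) (hd : 2 ≤ d) (w : ℝ → ℝ) (hw : IsWeight w) (J : ℕ)
    (f : Fin J → (EuclideanSpace ℝ (Fin d) → ℝ)) (hf : ∀ j, IsHarmonicOn (f j) (unitBall d))
    (C₁ C₂ : ℝ) (hC₁ : 0 < C₁) (hC₂ : 0 < C₂) (h : ∀ x ∈ unitBall d,
        C₁ * w ‖x‖ ≤ ∑ j, |f j x| ∧ ∑ j, |f j x| ≤ C₂ * w ‖x‖) :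
    ∃ a A : ℝ, 0 < a ∧ 0 < A ∧ ∀ δ ∈ Ioo (0:ℝ) 1, ∃ V : ℝ → ℝ,
      (∀ p q, p < 0 → q < 0 → V ((p + q) / 2) ^ 2 ≤ V p * V q) ∧
      ∀ t < 0, a * w (Real.exp t * Real.sqrt (1 - δ)) ^ 2 ≤ V t ∧ V t ≤ A * w (Real.exp t) ^ 2 := by
  obtain ⟨hcont, hmon, hpos, hunb⟩ := hw
  have hJ : 0 < (J:ℝ) := by
    rcases Nat.eq_zero_or_pos J with h0 | h0
    · subst h0
      have := (h 0 (by simp [unitBall])).1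
      have h3 := hpos 0 (by simp)
      simp only [Finset.univ_eq_empty, Finset.sum_empty, norm_zero] at this
      nlinarith
    · exact_mod_cast h0
  have hsq : ∀ x ∈ unitBall d, C₁ ^ 2 / J * w ‖x‖ ^ 2 ≤ ∑ j, f j x * f j x ∧
      ∑ j, f j x * f j x ≤ C₂ ^ 2 * w ‖x‖ ^ 2 := by
    intro x hx
    obtain ⟨h1, h2⟩ := h x hx
    have hwx : 0 < w ‖x‖ := hpos _ ⟨norm_nonneg _, by simpa [unitBall] using hx⟩
    have e : ∀ j, f j x * f j x = |f j x| ^ 2 := fun j => by rw [sq_abs]; ring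
    simp only [e]
    constructor
    · have h3 : (∑ j, |f j x|) ^ 2 ≤ J * ∑ j, |f j x| ^ 2 := by
        have := sq_sum_le_card_mul_sum_sq (s := Finset.univ) (f := fun j => |f j x|)
        simpa using this
      have h4 : (C₁ * w ‖x‖) ^ 2 ≤ (∑ j, |f j x|) ^ 2 := pow_le_pow_left₀ (by positivity) h1 2
      rw [div_mul_eq_mul_div, div_le_iff₀ hJ]
      nlinarith
    · have h3 : ∑ j, |f j x| ^ 2 ≤ (∑ j, |f j x|) ^ 2 :=
        Finset.sum_sq_le_sq_sum_of_nonneg (fun j _ => abs_nonneg _)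
      have h4 : (∑ j, |f j x|) ^ 2 ≤ (C₂ * w ‖x‖) ^ 2 :=
        pow_le_pow_left₀ (Finset.sum_nonneg (fun j _ => abs_nonneg _)) h2 2
      nlinarith
  refine ⟨C₁ ^ 2 / J, C₂ ^ 2, by positivity, by positivity, fun δ hδ => ?_⟩
  obtain ⟨ψ, hψc, hψ0, hψs, hψ1, hψe⟩ := kernel_exists d hd δ hδ
  set B := closedBall (0 : EuclideanSpace ℝ (Fin d)) 1 with hB
  have hBc : IsCompact B := isCompact_closedBall _ _
  have hin : ∀ t < 0, ∀ x ∈ B, Real.exp t • x ∈ unitBall d := by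
    intro t ht x hx
    rw [hB, mem_closedBall_zero_iff] at hx
    rw [unitBall, mem_ball_zero_iff, norm_smul, Real.norm_of_nonneg (Real.exp_pos t).le]
    have : Real.exp t < 1 := by simpa using ht
    nlinarith [Real.exp_pos t, norm_nonneg x]
  have hfc : ∀ j, ∀ t < 0, ContinuousOn (fun x => f j (Real.exp t • x)) B := fun j t ht =>
    (hf j).1.continuousOn.comp (by fun_prop) (fun x hx => hin t ht x hx)
  have hintg : ∀ p q, p < 0 → q < 0 → ∀ j, IntegrableOn
      (fun x => f j (Real.exp p • x) * f j (Real.exp q • x) * ψ x) B := fun p q hp hq j =>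
    (((hfc j p hp).mul (hfc j q hq)).mul hψc.continuousOn).integrableOn_compact hBc
  let V : ℝ → ℝ → ℝ := fun p q => ∫ x in B, ∑ j, f j (Real.exp p • x) * f j (Real.exp q • x) * ψ x
  have hVint : ∀ p q, p < 0 → q < 0 → IntegrableOn
      (fun x => ∑ j, f j (Real.exp p • x) * f j (Real.exp q • x) * ψ x) B := fun p q hp hq =>
    integrable_finsetSum _ (fun j _ => hintg p q hp hq j)
  have hVm : ∀ p q, p < 0 → q < 0 → V p q = V ((p + q) / 2) ((p + q) / 2) := by
    intro p q hp hq
    simp only [V]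
    rw [integral_finsetSum _ (fun j _ => hintg p q hp hq j),
      integral_finsetSum _ (fun j _ => hintg _ _ (by linarith) (by linarith) j)]
    exact Finset.sum_congr rfl (fun j _ => hψe (f j) (hf j) p q hp hq)
  have hVb : ∀ t < 0, C₁ ^ 2 / J * w (Real.exp t * Real.sqrt (1 - δ)) ^ 2 ≤ V t t ∧
      V t t ≤ C₂ ^ 2 * w (Real.exp t) ^ 2 := by
    intro t ht
    have hE := Real.exp_pos t
    have hE1 : Real.exp t < 1 := by simpa using ht
    have hs1 : Real.sqrt (1 - δ) ≤ 1 := Real.sqrt_le_one.2 (by linarith [hδ.1])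
    have hs0 := Real.sqrt_nonneg (1 - δ)
    have hψi : IntegrableOn ψ B := hψc.continuousOn.integrableOn_compact hBc
    have hm1 : Real.exp t * Real.sqrt (1 - δ) ∈ Ico (0:ℝ) 1 := ⟨by positivity, by nlinarith⟩
    have hm2 : Real.exp t ∈ Ico (0:ℝ) 1 := ⟨hE.le, hE1⟩
    have hpt : ∀ x ∈ B, C₁ ^ 2 / J * w (Real.exp t * Real.sqrt (1 - δ)) ^ 2 * ψ x ≤
        ∑ j, f j (Real.exp t • x) * f j (Real.exp t • x) * ψ x ∧
        ∑ j, f j (Real.exp t • x) * f j (Real.exp t • x) * ψ x ≤ C₂ ^ 2 * w (Real.exp t) ^ 2 * ψ x := by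
      intro x hx
      by_cases hψx : ψ x = 0
      · simp [hψx]
      have hn1 := hψs x hψx
      have hn2 : ‖x‖ ≤ 1 := by simpa [hB] using hx
      have hn3 : Real.sqrt (1 - δ) ≤ ‖x‖ := Real.sqrt_le_iff.2 ⟨norm_nonneg _, hn1⟩
      have hnx : ‖Real.exp t • x‖ = Real.exp t * ‖x‖ := by
        rw [norm_smul, Real.norm_of_nonneg hE.le]
      have hu := hin t ht x hx
      obtain ⟨h1, h2⟩ := hsq _ hu
      have hm3 : ‖Real.exp t • x‖ ∈ Ico (0:ℝ) 1 := ⟨norm_nonneg _, by simpa [unitBall] using hu⟩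
      have w1 : w (Real.exp t * Real.sqrt (1 - δ)) ≤ w ‖Real.exp t • x‖ :=
        hmon hm1 hm3 (by rw [hnx]; gcongr)
      have w2 : w ‖Real.exp t • x‖ ≤ w (Real.exp t) :=
        hmon hm3 hm2 (by rw [hnx]; nlinarith)
      have w3 := pow_le_pow_left₀ (hpos _ hm1).le w1 2
      have w4 := pow_le_pow_left₀ (hpos _ hm3).le w2 2
      rw [← Finset.sum_mul]
      constructor
      · apply mul_le_mul_of_nonneg_right _ (hψ0 x)
        exact (mul_le_mul_of_nonneg_left w3 (by positivity)).trans h1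
      · apply mul_le_mul_of_nonneg_right _ (hψ0 x)
        exact h2.trans (mul_le_mul_of_nonneg_left w4 (by positivity))
    constructor
    · have := setIntegral_mono_on (hψi.const_mul (C₁ ^ 2 / J * w (Real.exp t * Real.sqrt (1 - δ)) ^ 2))
        (hVint t t ht ht) hBc.measurableSet (fun x hx => (hpt x hx).1)
      rwa [integral_const_mul, hψ1, mul_one] at this
    · have := setIntegral_mono_on (hVint t t ht ht) (hψi.const_mul (C₂ ^ 2 * w (Real.exp t) ^ 2))
        hBc.measurableSet (fun x hx => (hpt x hx).2)
      rwa [integral_const_mul, hψ1, mul_one] at this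
  refine ⟨fun t => V t t, fun p q hp hq => ?_, hVb⟩
  have hquad : ∀ c : ℝ, 0 ≤ c ^ 2 * V p p - 2 * c * V p q + V q q := by
    intro c
    have e : c ^ 2 * V p p - 2 * c * V p q + V q q =
        ∫ x in B, ∑ j, (c * f j (Real.exp p • x) - f j (Real.exp q • x)) ^ 2 * ψ x := by
      simp only [V]
      rw [← integral_const_mul, ← integral_const_mul, ← integral_sub, ← integral_add]
      · congr 1
        funext x
        simp only [Finset.mul_sum, ← Finset.sum_sub_distrib, ← Finset.sum_add_distrib]
        apply Finset.sum_congr rfl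
        intro j _
        ring
      · exact ((hVint p p hp hp).const_mul _).sub ((hVint p q hp hq).const_mul _)
      · exact hVint q q hq hq
      · exact (hVint p p hp hp).const_mul _
      · exact (hVint p q hp hq).const_mul _
    rw [e]
    apply integral_nonneg
    intro x
    exact Finset.sum_nonneg (fun j _ => mul_nonneg (sq_nonneg _) (hψ0 x))
  have hVp : 0 < V p p := by
    refine lt_of_lt_of_le ?_ (hVb p hp).1
    have hE1 : Real.exp p < 1 := by simpa using hp
    have hs1 : Real.sqrt (1 - δ) ≤ 1 := Real.sqrt_le_one.2 (by linarith [hδ.1])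
    have hs0 := Real.sqrt_nonneg (1 - δ)
    have := hpos (Real.exp p * Real.sqrt (1 - δ)) ⟨by positivity, by nlinarith [Real.exp_pos p]⟩
    positivity
  have := hquad (V p q / V p p)
  simp only
  rw [← hVm p q hp hq]
  have e : (V p q / V p p) ^ 2 * V p p - 2 * (V p q / V p p) * V p q + V q q =
      (V p p * V q q - V p q ^ 2) / V p p := by
    field_simp; ring
  rw [e] at this
  have h3 := (div_nonneg_iff.1 this)
  rcases h3 with h3 | h3
  · linarith [h3.1]
  · linarith [h3.2]

lemma convex_of_midpoint (h : ℝ → ℝ) (hm : ∀ p q, p < 0 → q < 0 → h ((p + q) / 2) ≤ (h p + h q) / 2)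
    (hbd : ∀ b < 0, ∃ M, ∀ t ≤ b, h t ≤ M) : ConvexOn ℝ (Iio (0:ℝ)) h := by
  refine ⟨convex_Iio 0, ?_⟩
  intro x hx y hy a b ha hb hab
  simp only [smul_eq_mul]
  have hx0 : x < 0 := hx
  have hy0 : y < 0 := hy
  let g : ℝ → ℝ := fun s => h ((1 - s) * x + s * y) - ((1 - s) * h x + s * h y)
  have hneg : ∀ s ∈ Icc (0:ℝ) 1, (1 - s) * x + s * y ≤ max x y := by
    intro s hs
    have h1 := le_max_left x y
    have h2 := le_max_right x y
    nlinarith [hs.1, hs.2]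
  have hmax : max x y < 0 := max_lt hx0 hy0
  have gm : ∀ s ∈ Icc (0:ℝ) 1, ∀ t ∈ Icc (0:ℝ) 1, g ((s + t) / 2) ≤ (g s + g t) / 2 := by
    intro s hs t ht
    have := hm _ _ (lt_of_le_of_lt (hneg s hs) hmax) (lt_of_le_of_lt (hneg t ht) hmax)
    have e : ((1 - s) * x + s * y + ((1 - t) * x + t * y)) / 2 =
        (1 - (s + t) / 2) * x + ((s + t) / 2) * y := by ring
    rw [e] at this
    simp only [g]
    linarith
  have g0 : g 0 = 0 := by simp [g]
  have g1 : g 1 = 0 := by simp [g]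
  obtain ⟨M, hM⟩ := hbd _ hmax
  have hgb : BddAbove (g '' Icc (0:ℝ) 1) := by
    refine ⟨M + |h x| + |h y|, ?_⟩
    rintro _ ⟨s, hs, rfl⟩
    have h1 := hM _ (hneg s hs)
    simp only [g]
    have h2 := neg_abs_le (h x)
    have h3 := neg_abs_le (h y)
    have h4 := abs_nonneg (h x)
    have h5 := abs_nonneg (h y)
    nlinarith [hs.1, hs.2]
  set T := sSup (g '' Icc (0:ℝ) 1)
  have hT : ∀ s ∈ Icc (0:ℝ) 1, g s ≤ T := fun s hs => le_csSup hgb ⟨s, hs, rfl⟩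
  have hT2 : T ≤ T / 2 := by
    apply csSup_le (show (g '' Icc (0:ℝ) 1).Nonempty from ⟨g 0, 0, by simp, rfl⟩)
    rintro _ ⟨s, hs, rfl⟩
    rcases le_total s (1/2) with h2 | h2
    · have m2 : 2 * s ∈ Icc (0:ℝ) 1 := ⟨by linarith [hs.1], by linarith⟩
      have := gm 0 (by simp) (2 * s) m2
      rw [g0, show (0 + 2 * s) / 2 = s by ring] at this
      linarith [hT _ m2]
    · have m2 : 2 * s - 1 ∈ Icc (0:ℝ) 1 := ⟨by linarith, by linarith [hs.2]⟩
      have := gm 1 (by simp) (2 * s - 1) m2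
      rw [g1, show (1 + (2 * s - 1)) / 2 = s by ring] at this
      linarith [hT _ m2]
  have := hT b ⟨hb, by linarith⟩
  simp only [g] at this
  rw [show 1 - b = a by linarith] at this
  linarith

lemma mono_of_convex (h : ℝ → ℝ) (hc : ConvexOn ℝ (Iio (0:ℝ)) h)
    (hbd : ∀ b < 0, ∃ M, ∀ t ≤ b, h t ≤ M) : MonotoneOn h (Iio (0:ℝ)) := by
  intro p hp q hq hpq
  by_contra! hlt
  have hpq' : p < q := by
    rcases hpq.lt_or_eq with h1 | h1
    · exact h1
    · subst h1; exact absurd hlt (lt_irrefl _)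
  obtain ⟨M, hM⟩ := hbd p hp
  set σ := (h p - h q) / (q - p) with hσ
  have hσ0 : 0 < σ := div_pos (by linarith) (by linarith)
  set D := (M - h p + 1) / σ with hD
  have hD0 : 0 < D := div_pos (by linarith [hM p le_rfl]) hσ0
  have hs := hc.slope_mono_adjacent (x := p - D) (y := p) (z := q)
    (show p - D < 0 by have : p < 0 := hp; linarith) hq (by linarith) hpq'
  have e : (h q - h p) / (q - p) = -σ := by rw [hσ, ← neg_div]; congr 1; ring
  rw [e, div_le_iff₀ (by linarith)] at hs
  have := hM (p - D) (by linarith)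
  have e2 : σ * D = M - h p + 1 := by rw [hD]; field_simp
  nlinarith

lemma build_weight (w : ℝ → ℝ) (hw : IsWeight w) (h : ℝ → ℝ) (hc : ConvexOn ℝ (Iio (0:ℝ)) h)
    (hmo : MonotoneOn h (Iio (0:ℝ))) (C : ℝ)
    (hC : ∀ t < 0, |h t - Real.log (w (Real.exp t))| ≤ C) :
    ∃ v : ℝ → ℝ, IsWeight v ∧ IsLogConvex v ∧ EquivOn01 w v := by
  obtain ⟨hcont, hmon, hpos, hunb⟩ := hw
  have he1 : Real.exp (-1) < 1 := by simp
  have he0 := Real.exp_pos (-1)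
  let l : ℝ → ℝ := fun r => Real.log (max r (Real.exp (-1)))
  have hmx : ∀ r, 0 < max r (Real.exp (-1)) := fun r => lt_of_lt_of_le he0 (le_max_right _ _)
  have hl : ∀ r ∈ Ico (0:ℝ) 1, l r < 0 := fun r hr => Real.log_neg (hmx r) (max_lt hr.2 he1)
  have hlm : Monotone l := fun r s hrs => Real.log_le_log (hmx r) (max_le_max_right _ hrs)
  have hlc : Continuous l := (continuous_id.max continuous_const).log (fun r => (hmx r).ne')
  have hhc : ContinuousOn h (Iio (0:ℝ)) := hc.continuousOn isOpen_Iio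
  let v : ℝ → ℝ := fun r => Real.exp (h (l r))
  have h0 : (0:ℝ) ∈ Ico (0:ℝ) 1 := by simp
  have hw0 := hpos 0 h0
  have hcmp : ∀ r ∈ Ico (0:ℝ) 1, w r ≤ Real.exp C * v r := by
    intro r hr
    have hm : max r (Real.exp (-1)) ∈ Ico (0:ℝ) 1 := ⟨(hmx r).le, max_lt hr.2 he1⟩
    have h1 : w r ≤ w (max r (Real.exp (-1))) := hmon hr hm (le_max_left _ _)
    have h2 := (abs_le.1 (hC (l r) (hl r hr))).1
    rw [Real.exp_log (hmx r)] at h2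
    refine h1.trans ?_
    rw [← Real.exp_log (hpos _ hm), ← Real.exp_add]
    exact Real.exp_le_exp.2 (by linarith)
  refine ⟨v, ⟨?_, ?_, fun r _ => Real.exp_pos _, ?_⟩, ?_, ?_⟩
  · exact Real.continuous_exp.comp_continuousOn (hhc.comp hlc.continuousOn (fun r hr => hl r hr))
  · intro r hr s hs hrs
    exact Real.exp_le_exp.2 (hmo (hl r hr) (hl s hs) (hlm hrs))
  · intro M
    obtain ⟨r, hr, hM⟩ := hunb (Real.exp C * M)
    refine ⟨r, hr, ?_⟩
    exact lt_of_mul_lt_mul_left (hM.trans_le (hcmp r hr)) (Real.exp_pos C).le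
  · have hsup : ConvexOn ℝ (Iio (0:ℝ)) (h ⊔ fun _ => h (-1)) :=
      hc.sup (convexOn_const _ (convex_Iio 0))
    refine hsup.congr ?_
    intro t ht
    have ht0 : t < 0 := ht
    simp only [v, Real.log_exp, Pi.sup_apply, l]
    rcases le_total t (-1) with h1 | h1
    · rw [max_eq_right (Real.exp_le_exp.2 h1), Real.log_exp]
      exact sup_eq_right.2 (hmo ht (by simp) h1)
    · rw [max_eq_left (Real.exp_le_exp.2 h1), Real.log_exp]
      exact sup_eq_left.2 (hmo (by simp) ht h1)
  · refine ⟨min (Real.exp (-C)) (w 0 / Real.exp (h (-1))), Real.exp C, ?_, Real.exp_pos C,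
      fun r hr => ⟨?_, hcmp r hr⟩⟩
    · exact lt_min (Real.exp_pos _) (div_pos hw0 (Real.exp_pos _))
    · have hv0 : 0 ≤ v r := (Real.exp_pos _).le
      rcases le_total r (Real.exp (-1)) with h1 | h1
      · have e : v r = Real.exp (h (-1)) := by
          simp only [v, l]; rw [max_eq_right h1, Real.log_exp]
        calc _ ≤ w 0 / Real.exp (h (-1)) * v r := mul_le_mul_of_nonneg_right (min_le_right _ _) hv0
          _ = w 0 := by rw [e]; field_simp
          _ ≤ w r := hmon h0 hr hr.1
      · have h2 := (abs_le.1 (hC (l r) (hl r hr))).2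
        rw [Real.exp_log (hmx r), max_eq_left h1] at h2
        calc _ ≤ Real.exp (-C) * v r := mul_le_mul_of_nonneg_right (min_le_left _ _) hv0
          _ ≤ w r := by
            rw [← Real.exp_log (hpos r hr)]
            simp only [v]
            rw [← Real.exp_add]
            exact Real.exp_le_exp.2 (by linarith)

lemma only_if_dir (d : ℕ) (hd : 2 ≤ d) (w : ℝ → ℝ) (hw : IsWeight w) (J : ℕ)
    (f : Fin J → (EuclideanSpace ℝ (Fin d) → ℝ)) (hf : ∀ j, IsHarmonicOn (f j) (unitBall d))
    (C₁ C₂ : ℝ) (hC₁ : 0 < C₁) (hC₂ : 0 < C₂) (h : ∀ x ∈ unitBall d,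
        C₁ * w ‖x‖ ≤ ∑ j, |f j x| ∧ ∑ j, |f j x| ≤ C₂ * w ‖x‖) :
    ∃ v : ℝ → ℝ, IsWeight v ∧ IsLogConvex v ∧ EquivOn01 w v := by
  obtain ⟨a, A, ha, hA, hV⟩ := energy_family d hd w hw J f hf C₁ C₂ hC₁ hC₂ h
  choose! V hV1 hV2 using hV
  have hw' := hw
  obtain ⟨hcont, hmon, hpos, hunb⟩ := hw
  let H : Ioo (0:ℝ) 1 → ℝ → ℝ := fun δ t => Real.log (V δ t) / 2
  have hmem : ∀ t < 0, Real.exp t ∈ Ico (0:ℝ) 1 := fun t ht => ⟨(Real.exp_pos t).le, by simpa using ht⟩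
  have hmem2 : ∀ t < 0, ∀ δ ∈ Ioo (0:ℝ) 1, Real.exp t * Real.sqrt (1 - δ) ∈ Ico (0:ℝ) 1 := by
    intro t ht δ hδ
    have hs1 : Real.sqrt (1 - δ) ≤ 1 := Real.sqrt_le_one.2 (by linarith [hδ.1])
    have hs0 := Real.sqrt_nonneg (1 - δ)
    exact ⟨mul_nonneg (Real.exp_pos t).le hs0, by nlinarith [Real.exp_pos t, (hmem t ht).2]⟩
  have hVpos : ∀ δ ∈ Ioo (0:ℝ) 1, ∀ t < 0, 0 < V δ t := by
    intro δ hδ t ht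
    refine lt_of_lt_of_le ?_ (hV2 δ hδ t ht).1
    have := hpos _ (hmem2 t ht δ hδ)
    positivity
  have hHm : ∀ δ, ∀ p q, p < 0 → q < 0 → H δ ((p + q) / 2) ≤ (H δ p + H δ q) / 2 := by
    intro δ p q hp hq
    have h1 := hVpos δ δ.2 p hp
    have h2 := hVpos δ δ.2 q hq
    have h3 := hVpos δ δ.2 ((p + q) / 2) (by linarith)
    have h4 := Real.log_le_log (by positivity) (hV1 δ δ.2 p q hp hq)
    rw [Real.log_mul h1.ne' h2.ne', Real.log_pow] at h4
    simp only [H]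
    push_cast at h4
    linarith
  have hHu : ∀ δ, ∀ t < 0, H δ t ≤ Real.log A / 2 + Real.log (w (Real.exp t)) := by
    intro δ t ht
    have hwt := hpos _ (hmem t ht)
    have h4 := Real.log_le_log (hVpos δ δ.2 t ht) (hV2 δ δ.2 t ht).2
    rw [Real.log_mul hA.ne' (by positivity), Real.log_pow] at h4
    simp only [H]
    push_cast at h4
    linarith
  have hHl : ∀ δ : Ioo (0:ℝ) 1, ∀ t < 0, Real.log a / 2 + Real.log (w (Real.exp t * Real.sqrt (1 - δ))) ≤ H δ t := by
    intro δ t ht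
    have hwt := hpos _ (hmem2 t ht δ δ.2)
    have h4 := Real.log_le_log (by positivity) (hV2 δ δ.2 t ht).1
    rw [Real.log_mul ha.ne' (by positivity), Real.log_pow] at h4
    simp only [H]
    push_cast at h4
    linarith
  have : Nonempty (Ioo (0:ℝ) 1) := ⟨⟨1/2, by norm_num⟩⟩
  let hh : ℝ → ℝ := fun t => ⨆ δ : Ioo (0:ℝ) 1, H δ t
  have hbdd : ∀ t < 0, BddAbove (range (fun δ : Ioo (0:ℝ) 1 => H δ t)) := by
    intro t ht
    refine ⟨Real.log A / 2 + Real.log (w (Real.exp t)), ?_⟩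
    rintro _ ⟨δ, rfl⟩
    exact hHu δ t ht
  have hle : ∀ δ, ∀ t < 0, H δ t ≤ hh t := fun δ t ht => le_ciSup (hbdd t ht) δ
  have hup : ∀ t < 0, hh t ≤ Real.log A / 2 + Real.log (w (Real.exp t)) := fun t ht =>
    ciSup_le (fun δ => hHu δ t ht)
  have hlo : ∀ t < 0, Real.log a / 2 + Real.log (w (Real.exp t)) - 1 ≤ hh t := by
    intro t ht
    have hwt := hpos _ (hmem t ht)
    -- continuity of w at exp t
    have hc1 : ContinuousAt (fun r => Real.log (w r)) (Real.exp t) := by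
      have : ContinuousAt w (Real.exp t) :=
        hcont.continuousAt (Ico_mem_nhds (Real.exp_pos t) (hmem t ht).2)
      exact this.log hwt.ne'
    have hc2 : ContinuousAt (fun δ : ℝ => Real.exp t * Real.sqrt (1 - δ)) 0 := by fun_prop
    have hc3 : Filter.Tendsto (fun δ : ℝ => Real.log (w (Real.exp t * Real.sqrt (1 - δ)))) (nhds 0)
        (nhds (Real.log (w (Real.exp t)))) := by
      have hc1' : ContinuousAt (fun r => Real.log (w r)) (Real.exp t * Real.sqrt (1 - 0)) := by simpa using hc1
      have := (ContinuousAt.comp (f := fun δ : ℝ => Real.exp t * Real.sqrt (1 - δ)) (x := 0) hc1' hc2).tendsto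
      simpa [Function.comp_def] using this
    have hev := hc3.eventually (Ioi_mem_nhds (show Real.log (w (Real.exp t)) - 1 < Real.log (w (Real.exp t)) by linarith))
    have hev2 : ∀ᶠ δ in nhdsWithin (0:ℝ) (Ioi 0), Real.log (w (Real.exp t)) - 1 <
        Real.log (w (Real.exp t * Real.sqrt (1 - δ))) ∧ δ ∈ Ioo (0:ℝ) 1 :=
      (hev.filter_mono nhdsWithin_le_nhds).and (Ioo_mem_nhdsGT one_pos)
    obtain ⟨δ, h1, h2⟩ := hev2.exists
    have h3 := hHl ⟨δ, h2⟩ t ht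
    have h4 := hle ⟨δ, h2⟩ t ht
    simp only at h3
    linarith
  have hbd : ∀ b < 0, ∃ M, ∀ t ≤ b, hh t ≤ M := by
    intro b hb
    refine ⟨Real.log A / 2 + Real.log (w (Real.exp b)), fun t ht => ?_⟩
    have ht0 : t < 0 := by linarith
    have := Real.log_le_log (hpos _ (hmem t ht0)) (hmon (hmem t ht0) (hmem b hb) (Real.exp_le_exp.2 ht))
    linarith [hup t ht0]
  have hconv : ConvexOn ℝ (Iio (0:ℝ)) hh := by
    apply convex_of_midpoint hh _ hbd
    intro p q hp hq
    apply ciSup_le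
    intro δ
    linarith [hHm δ p q hp hq, hle δ p hp, hle δ q hq]
  refine build_weight w hw' hh hconv (mono_of_convex hh hconv hbd) (|Real.log A / 2| + |Real.log a / 2| + 1) ?_
  intro t ht
  rw [abs_le]
  constructor
  · linarith [hlo t ht, neg_abs_le (Real.log a / 2), abs_nonneg (Real.log A / 2)]
  · linarith [hup t ht, le_abs_self (Real.log A / 2), abs_nonneg (Real.log a / 2)]

theorem stmt18 (d : ℕ) (hd : 2 ≤ d) (heven : Even d) (w : ℝ → ℝ) (hw : IsWeight w) :
    (∃ (J : ℕ) (f : Fin J → (EuclideanSpace ℝ (Fin d) → ℝ)),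
      (∀ j, IsHarmonicOn (f j) (unitBall d)) ∧
      ∃ C₁ C₂ : ℝ, 0 < C₁ ∧ 0 < C₂ ∧ ∀ x ∈ unitBall d,
        C₁ * w ‖x‖ ≤ ∑ j, |f j x| ∧ ∑ j, |f j x| ≤ C₂ * w ‖x‖) ↔
    ∃ v : ℝ → ℝ, IsWeight v ∧ IsLogConvex v ∧ EquivOn01 w v := by
  constructor
  · rintro ⟨J, f, hf, C₁, C₂, hC₁, hC₂, h⟩
    exact only_if_dir d hd w hw J f hf C₁ C₂ hC₁ hC₂ h
  · rintro ⟨v, hv, hlc, c₁, c₂, hc₁, hc₂, hwv⟩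
    obtain ⟨r, rfl⟩ := heven
    obtain ⟨m, rfl⟩ : ∃ m, r = m + 1 := ⟨r - 1, by omega⟩
    obtain ⟨J, f, hf, C₁, C₂, hC₁, hC₂, h⟩ := if_dir m v hv hlc
    refine ⟨J, f, hf, C₁ / c₂, C₂ / c₁, by positivity, by positivity, fun x hx => ?_⟩
    obtain ⟨h1, h2⟩ := h x hx
    have hx1 : ‖x‖ ∈ Set.Ico (0:ℝ) 1 := ⟨norm_nonneg _, by simpa [unitBall] using hx⟩
    obtain ⟨h3, h4⟩ := hwv _ hx1
    constructor
    · refine le_trans ?_ h1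
      rw [div_mul_eq_mul_div, div_le_iff₀ hc₂]
      nlinarith
    · refine h2.trans ?_
      rw [div_mul_eq_mul_div, le_div_iff₀ hc₁]
      nlinarith
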